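/- Let (X,d) be a complete separable metric space in which closed balls are compact, let α be a Young function satisfying the Δ₂-condition, and let μ be a probability measure on X. If μ satisfies the modified log-Sobolev inequality minus LSI⁻_α(A) for some A > 0, then μ satisfies the transport-entropy inequality T_α(B⁻), where B⁻ = lim_{t→t_α} (1/t)·exp( ∫₀^t A·ξ_α(u) / (u·(1 + A·ξ_α(u))) du ), with ξ_α(x) = sup_{u>0} α*(x·α'₊(u)) / (x·α(u)) and t_α = sup{ t ∈ [0,∞) : ξ_α(t) < +∞ }. -/

import Mathlib

open MeasureTheory Filter Set Topology
open scoped ENNReal NNReal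

noncomputable section

/-- The right derivative of a function `α : ℝ → ℝ`. -/
def rightD (α : ℝ → ℝ) (x : ℝ) : ℝ := derivWithin α (Set.Ioi x) x

/-- The left derivative of a function `α : ℝ → ℝ`. -/
def leftD (α : ℝ → ℝ) (x : ℝ) : ℝ := derivWithin α (Set.Iio x) x

/-- A Young function: an even, convex, nonnegative function, increasing on `[0,∞)`,
vanishing at `0` and with vanishing right derivative at `0`. -/
structure IsYoung (α : ℝ → ℝ) : Prop where
  nonneg : ∀ x, 0 ≤ α x
  even : ∀ x, α (-x) = α x
  convex : ConvexOn ℝ Set.univ α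
  mono : StrictMonoOn α (Set.Ici 0)
  zero : α 0 = 0
  rightD_zero : rightD α 0 = 0

/-- The Δ₂-condition for a Young function. -/
def DeltaTwo (α : ℝ → ℝ) : Prop := ∃ K > 0, ∀ x : ℝ, α (2 * x) ≤ K * α x

/-- `r_α = inf_{x>0} x α'₋(x)/α(x)`. -/
def rAlpha (α : ℝ → ℝ) : ℝ := sInf {r : ℝ | ∃ x > 0, r = x * leftD α x / α x}

/-- `p_α = sup_{x>0} x α'₊(x)/α(x)`. -/
def pAlpha (α : ℝ → ℝ) : ℝ := sSup {r : ℝ | ∃ x > 0, r = x * rightD α x / α x}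

/-- The Fenchel-Legendre transform `α*(y) = sup_x {xy - α(x)}`, with values in `[0,∞]`. -/
def legendre (α : ℝ → ℝ) (y : ℝ) : ℝ≥0∞ := ⨆ x : ℝ, ENNReal.ofReal (x * y - α x)

/-- `ξ_α(t) = sup_{u>0} α*(t α'₊(u)) / (t α(u))`. -/
def xiAlpha (α : ℝ → ℝ) (t : ℝ) : ℝ≥0∞ :=
  ⨆ u : {u : ℝ // 0 < u}, legendre α (t * rightD α u) / ENNReal.ofReal (t * α u)

/-- A bounded real-valued function. -/
def IsBoundedFun {Y : Type*} (f : Y → ℝ) : Prop := ∃ M, ∀ x, |f x| ≤ M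

variable {X : Type*} [MetricSpace X] [MeasurableSpace X]

/-- The optimal transport cost `T_α(ν,μ)` between two measures, for the cost
function `(x,y) ↦ α(d(x,y))`. -/
def transportCost (α : ℝ → ℝ) (ν μ : Measure X) : ℝ≥0∞ :=
  sInf { c : ℝ≥0∞ | ∃ π : Measure (X × X), π.map Prod.fst = ν ∧ π.map Prod.snd = μ ∧
      c = ∫⁻ z, ENNReal.ofReal (α (dist z.1 z.2)) ∂π }

open Classical in
/-- The relative entropy `H(ν|μ) = ∫ log (dν/dμ) dν` if `ν ≪ μ` (and `+∞` if `ν` is not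
absolutely continuous with respect to `μ`, or if the integral diverges). -/
def relEnt (ν μ : Measure X) : ℝ≥0∞ :=
  if ν ≪ μ ∧ Integrable (fun x => Real.log (ν.rnDeriv μ x).toReal) ν
  then ENNReal.ofReal (∫ x, Real.log (ν.rnDeriv μ x).toReal ∂ν) else ⊤

/-- The transport-entropy inequality `T_α(C)`: for every probability measure `ν`,
`T_α(ν,μ) ≤ C H(ν|μ)`. -/
def TransportEntropy (μ : Measure X) (α : ℝ → ℝ) (C : ℝ) : Prop :=
  ∀ ν : Measure X, IsProbabilityMeasure ν →
    transportCost α ν μ ≤ ENNReal.ofReal C * relEnt ν μ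

/-- The entropy functional `Ent_μ(e^f)`. -/
def entExp (μ : Measure X) (f : X → ℝ) : ℝ :=
  ∫ x, Real.exp (f x) * Real.log (Real.exp (f x)) ∂μ
    - (∫ x, Real.exp (f x) ∂μ) * Real.log (∫ x, Real.exp (f x) ∂μ)

/-- `|∇⁺ f|(x) = limsup_{y → x} [f(y) - f(x)]₊ / d(y,x)` (equal to `0` at isolated
points by the conventions on `limsup` and `sInf` in `ℝ`). -/
def gradPlus (f : X → ℝ) (x : X) : ℝ :=
  limsup (fun y => max (f y - f x) 0 / dist y x) (𝓝[≠] x)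

/-- `|∇⁻ f|(x) = limsup_{y → x} [f(y) - f(x)]₋ / d(y,x)` (equal to `0` at isolated
points by the conventions on `limsup` and `sInf` in `ℝ`). -/
def gradMinus (f : X → ℝ) (x : X) : ℝ :=
  limsup (fun y => max (-(f y - f x)) 0 / dist y x) (𝓝[≠] x)

/-- The modified log-Sobolev inequality plus `LSI⁺_α(A)`. -/
def LSIplus (μ : Measure X) (α : ℝ → ℝ) (A : ℝ) : Prop :=
  ∀ f : X → ℝ, IsBoundedFun f → LocallyLipschitz f →
    ENNReal.ofReal (entExp μ f) ≤
      ENNReal.ofReal A * ∫⁻ x, legendre α (gradPlus f x) * ENNReal.ofReal (Real.exp (f x)) ∂μ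

/-- The modified log-Sobolev inequality minus `LSI⁻_α(A)`. -/
def LSIminus (μ : Measure X) (α : ℝ → ℝ) (A : ℝ) : Prop :=
  ∀ f : X → ℝ, IsBoundedFun f → LocallyLipschitz f →
    ENNReal.ofReal (entExp μ f) ≤
      ENNReal.ofReal A * ∫⁻ x, legendre α (gradMinus f x) * ENNReal.ofReal (Real.exp (f x)) ∂μ

/-- The inf-convolution operator `Q_α^λ f(x) = inf_y {f(y) + λ α(d(x,y))}`. -/
def QInf (α : ℝ → ℝ) (lam : ℝ) (f : X → ℝ) (x : X) : ℝ :=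
  ⨅ y : X, (f y + lam * α (dist x y))

/-- The `(τ)`-log-Sobolev inequality `(τ)-LSI_α(λ, A)`. -/
def TauLSI (μ : Measure X) (α : ℝ → ℝ) (lam A : ℝ) : Prop :=
  ∀ f : X → ℝ, IsBoundedFun f → LocallyLipschitz f →
    entExp μ f ≤ A * ∫ x, (f x - QInf α lam f x) * Real.exp (f x) ∂μ

/-- The `n`-dimensional inf-convolution operator
`Q_{α,n} f(x) = inf_y {f(y) + Σᵢ α(d(xᵢ,yᵢ))}`. -/
def QInfN (α : ℝ → ℝ) {n : ℕ} (f : (Fin n → X) → ℝ) (x : Fin n → X) : ℝ :=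
  ⨅ y : Fin n → X, (f y + ∑ i, α (dist (x i) (y i)))

/-- The `n`-dimensional sup-convolution operator
`P_{α,n} f(x) = sup_y {f(y) - Σᵢ α(d(xᵢ,yᵢ))}`. -/
def PSupN (α : ℝ → ℝ) {n : ℕ} (f : (Fin n → X) → ℝ) (x : Fin n → X) : ℝ :=
  ⨆ y : Fin n → X, (f y - ∑ i, α (dist (x i) (y i)))

end

open scoped BoundedContinuousFunction CompactlySupported

section Kantorovich

/-- A positive linear functional on bounded continuous functions that is tight along a sequence of
compactly supported cut-offs is represented by a finite measure. -/
lemma exists_finiteMeasure_of_tight_functional {Y : Type*} [TopologicalSpace Y] [T2Space Y]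
    [LocallyCompactSpace Y] [MeasurableSpace Y] [BorelSpace Y]
    (Λ : (Y →ᵇ ℝ) →ₗ[ℝ] ℝ) (hpos : ∀ u : Y →ᵇ ℝ, (∀ y, 0 ≤ u y) → 0 ≤ Λ u)
    (χ : ℕ → C_c(Y, ℝ)) (h0 : ∀ n y, 0 ≤ χ n y) (h1 : ∀ n y, χ n y ≤ 1)
    (hlim : ∀ y, Tendsto (fun n => χ n y) atTop (𝓝 1))
    (hΛ : Tendsto (fun n => Λ (χ n).toBoundedContinuousFunction) atTop (𝓝 (Λ 1))) :
    ∃ π : Measure Y, IsFiniteMeasure π ∧ ∀ u : Y →ᵇ ℝ, ∫ y, u y ∂π = Λ u := by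
  have hmono : ∀ u v : Y →ᵇ ℝ, (∀ y, u y ≤ v y) → Λ u ≤ Λ v := fun u v huv => by
    have := hpos (v - u) (fun y => by simpa using huv y)
    rw [map_sub] at this
    linarith
  let L : C_c(Y, ℝ) →ₗ[ℝ] ℝ :=
    { toFun := fun f => Λ f.toBoundedContinuousFunction
      map_add' := fun f g => by rw [← map_add]; rfl
      map_smul' := fun c f => by rw [RingHom.id_apply, ← map_smul]; rfl }
  let Lp : C_c(Y, ℝ) →ₚ[ℝ] ℝ := PositiveLinearMap.mk₀ L (fun f hf => hpos _ (fun y => hf y))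
  let π : Measure Y := RealRMK.rieszMeasure Lp
  have hrep : ∀ f : C_c(Y, ℝ), ∫ y, f y ∂π = Λ f.toBoundedContinuousFunction :=
    fun f => RealRMK.integral_rieszMeasure Lp f
  have hInt : ∀ f : C_c(Y, ℝ), Integrable f π := fun f =>
    f.continuous.integrable_of_hasCompactSupport f.hasCompactSupport
  have hfin : IsFiniteMeasure π := by
    refine ⟨?_⟩
    have hle : ∀ n, ∫⁻ y, ENNReal.ofReal (χ n y) ∂π ≤ ENNReal.ofReal (Λ 1) := fun n => by
      rw [← ofReal_integral_eq_lintegral_ofReal (hInt _) (ae_of_all _ (h0 n)), hrep]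
      exact ENNReal.ofReal_le_ofReal (hmono _ _ fun y => h1 n y)
    have hF := lintegral_liminf_le (μ := π) (u := atTop) (f := fun n y => ENNReal.ofReal (χ n y))
      (fun n => (χ n).continuous.measurable.ennreal_ofReal)
    have heq : ∀ y, liminf (fun n => ENNReal.ofReal (χ n y)) atTop = 1 := fun y => by
      have := ((ENNReal.continuous_ofReal.tendsto 1).comp (hlim y)).liminf_eq
      simpa [Function.comp_def] using this
    simp only [heq, lintegral_one] at hF
    exact (hF.trans (liminf_le_of_frequently_le' (Frequently.of_forall hle))).trans_lt
      ENNReal.ofReal_lt_top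
  refine ⟨π, hfin, fun u => ?_⟩
  let v : ℕ → C_c(Y, ℝ) := fun n =>
    ⟨⟨fun y => u y * χ n y, u.continuous.mul (χ n).continuous⟩,
      (χ n).hasCompactSupport.mul_left⟩
  have hl1 : Tendsto (fun n => ∫ y, v n y ∂π) atTop (𝓝 (∫ y, u y ∂π)) := by
    refine tendsto_integral_of_dominated_convergence (fun _ => ‖u‖)
      (fun n => (hInt _).aestronglyMeasurable) (integrable_const _) (fun n => ae_of_all _ fun y => ?_)
      (ae_of_all _ fun y => ?_)
    · change ‖u y * χ n y‖ ≤ ‖u‖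
      rw [norm_mul]
      have h2 : ‖χ n y‖ ≤ 1 := by
        rw [Real.norm_eq_abs, abs_of_nonneg (h0 n y)]; exact h1 n y
      calc ‖u y‖ * ‖χ n y‖ ≤ ‖u‖ * 1 :=
            mul_le_mul (u.norm_coe_le_norm y) h2 (norm_nonneg _) (norm_nonneg _)
        _ = ‖u‖ := mul_one _
    · change Tendsto (fun n => u y * χ n y) atTop (𝓝 (u y))
      simpa using (hlim y).const_mul (u y)
  have hl2 : Tendsto (fun n => ∫ y, v n y ∂π) atTop (𝓝 (Λ u)) := by
    have hb : ∀ n, |Λ (v n).toBoundedContinuousFunction - Λ u|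
        ≤ ‖u‖ * (Λ 1 - Λ (χ n).toBoundedContinuousFunction) := fun n => by
      have e : ‖u‖ * (Λ 1 - Λ (χ n).toBoundedContinuousFunction)
          = Λ (‖u‖ • (1 - (χ n).toBoundedContinuousFunction)) := by
        rw [map_smul, map_sub, smul_eq_mul]
      have hp : ∀ y, |u y| ≤ ‖u‖ := fun y => u.norm_coe_le_norm y
      rw [e, ← map_sub, abs_le, ← map_neg]
      constructor
      · refine hmono _ _ fun y => ?_
        change -(‖u‖ * (1 - χ n y)) ≤ u y * χ n y - u y
        nlinarith [abs_le.1 (hp y), h1 n y]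
      · refine hmono _ _ fun y => ?_
        change u y * χ n y - u y ≤ ‖u‖ * (1 - χ n y)
        nlinarith [abs_le.1 (hp y), h1 n y]
    rw [tendsto_iff_dist_tendsto_zero]
    refine squeeze_zero (fun _ => dist_nonneg) (fun n => ?_)
      (g := fun n => ‖u‖ * (Λ 1 - Λ (χ n).toBoundedContinuousFunction)) ?_
    · rw [hrep, Real.dist_eq]; exact hb n
    · simpa using (hΛ.const_sub (Λ 1)).const_mul ‖u‖
  exact tendsto_nhds_unique hl1 hl2

/-- The continuous cut-off `x ↦ max 0 (min 1 (n - d(x, a)))` on a proper metric space. -/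
noncomputable def ballCutoff {X : Type*} [MetricSpace X] [ProperSpace X] (a : X) (n : ℕ) :
    C_c(X, ℝ) where
  toFun x := max 0 (min 1 ((n : ℝ) - dist x a))
  continuous_toFun := by fun_prop
  hasCompactSupport' := by
    refine HasCompactSupport.of_support_subset_isCompact (isCompact_closedBall a (n : ℝ)) ?_
    intro x hx
    rw [Metric.mem_closedBall]
    by_contra hcon
    exact hx (max_eq_left ((min_le_right _ _).trans (by linarith)))

lemma ballCutoff_nonneg {X : Type*} [MetricSpace X] [ProperSpace X] (a : X) (n : ℕ) (x : X) :
    0 ≤ ballCutoff a n x := le_max_left _ _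

lemma ballCutoff_le_one {X : Type*} [MetricSpace X] [ProperSpace X] (a : X) (n : ℕ) (x : X) :
    ballCutoff a n x ≤ 1 := max_le zero_le_one (min_le_left _ _)

lemma tendsto_ballCutoff {X : Type*} [MetricSpace X] [ProperSpace X] (a x : X) :
    Tendsto (fun n => ballCutoff a n x) atTop (𝓝 1) := by
  refine tendsto_const_nhds.congr' ?_
  filter_upwards [eventually_ge_atTop ⌈1 + dist x a⌉₊] with n hn
  have : 1 + dist x a ≤ n := Nat.ceil_le.1 hn
  change (1 : ℝ) = max 0 (min 1 ((n : ℝ) - dist x a))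
  rw [min_eq_left (by linarith), max_eq_right zero_le_one]

lemma tendsto_integral_ballCutoff {X : Type*} [MetricSpace X] [ProperSpace X] [MeasurableSpace X]
    [BorelSpace X] (ν : Measure X) [IsProbabilityMeasure ν] (a : X) :
    Tendsto (fun n => ∫ x, ballCutoff a n x ∂ν) atTop (𝓝 1) := by
  have : Tendsto (fun n => ∫ x, ballCutoff a n x ∂ν) atTop (𝓝 (∫ _, (1 : ℝ) ∂ν)) := by
    refine tendsto_integral_of_dominated_convergence (fun _ => (1 : ℝ))
      (fun n => (ballCutoff a n).continuous.aestronglyMeasurable) (integrable_const _)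
      (fun n => ae_of_all _ fun x => ?_) (ae_of_all _ fun x => tendsto_ballCutoff a x)
    rw [Real.norm_eq_abs, abs_of_nonneg (ballCutoff_nonneg a n x)]
    exact ballCutoff_le_one a n x
  simpa using this

variable {X : Type*} [MetricSpace X] [MeasurableSpace X] [BorelSpace X]

/-- Hahn-Banach step of Kantorovich duality: a positive functional on bounded continuous functions
on `X × X` with prescribed marginals and cost at most `H`. -/
lemma exists_coupling_functional (ν μ : Measure X) [IsProbabilityMeasure ν]
    [IsProbabilityMeasure μ] (h : X → X → ℝ) (h_nonneg : ∀ x y, 0 ≤ h x y) (H : ℝ)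
    (hdual : ∀ φ ψ : X →ᵇ ℝ, (∀ x y, φ x - ψ y ≤ h x y) → ∫ x, φ x ∂ν - ∫ x, ψ x ∂μ ≤ H) :
    ∃ Λ : (X × X →ᵇ ℝ) →ₗ[ℝ] ℝ, ∀ (u : X × X →ᵇ ℝ) (φ ψ : X →ᵇ ℝ) (l : ℝ), 0 ≤ l →
      (∀ x y, u (x, y) ≤ φ x + ψ y + l * h x y) → Λ u ≤ ∫ x, φ x ∂ν + ∫ x, ψ x ∂μ + l * H := by
  have hH : 0 ≤ H := by simpa using hdual 0 0 (by simpa using h_nonneg)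
  have base_pos : ∀ (φ ψ : X →ᵇ ℝ) (l : ℝ), 0 < l → (∀ x y, 0 ≤ φ x + ψ y + l * h x y) →
      0 ≤ ∫ x, φ x ∂ν + ∫ x, ψ x ∂μ + l * H := by
    intro φ ψ l hl hle
    have := hdual ((-l⁻¹) • φ) (l⁻¹ • ψ) (fun x y => by
      have := mul_le_mul_of_nonneg_left (hle x y) (inv_nonneg.2 hl.le)
      have e : l⁻¹ * (φ x + ψ y + l * h x y) = l⁻¹ * φ x + l⁻¹ * ψ y + h x y := by
        field_simp
      simp only [BoundedContinuousFunction.coe_smul, smul_eq_mul]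
      linarith)
    simp only [BoundedContinuousFunction.coe_smul, smul_eq_mul, integral_const_mul] at this
    have h2 := mul_le_mul_of_nonneg_left this hl.le
    have e : l * (-l⁻¹ * ∫ x, φ x ∂ν - l⁻¹ * ∫ x, ψ x ∂μ) = -∫ x, φ x ∂ν - ∫ x, ψ x ∂μ := by
      field_simp
    linarith
  have base : ∀ (φ ψ : X →ᵇ ℝ) (l : ℝ), 0 ≤ l → (∀ x y, 0 ≤ φ x + ψ y + l * h x y) →
      0 ≤ ∫ x, φ x ∂ν + ∫ x, ψ x ∂μ + l * H := by
    intro φ ψ l hl hle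
    refine le_of_forall_pos_le_add fun ε hε => ?_
    have := base_pos φ ψ (l + ε / (H + 1)) (by positivity) (fun x y => by
      have h3 : 0 ≤ ε / (H + 1) * h x y := mul_nonneg (by positivity) (h_nonneg x y)
      linarith [hle x y])
    have h4 : ε / (H + 1) * H ≤ ε := by
      rw [div_mul_eq_mul_div, div_le_iff₀ (by positivity)]; nlinarith
    linarith
  let S : (X × X →ᵇ ℝ) → Set ℝ := fun u => {r | ∃ (φ ψ : X →ᵇ ℝ) (l : ℝ), 0 ≤ l ∧
      (∀ x y, u (x, y) ≤ φ x + ψ y + l * h x y) ∧ r = ∫ x, φ x ∂ν + ∫ x, ψ x ∂μ + l * H}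
  have hne : ∀ u, (S u).Nonempty := fun u =>
    ⟨_, BoundedContinuousFunction.const X ‖u‖, 0, 0, le_rfl, fun x y => by
      simpa using (le_abs_self _).trans (u.norm_coe_le_norm (x, y)), rfl⟩
  have hInt : ∀ (ρ : Measure X) [IsProbabilityMeasure ρ] (φ : X →ᵇ ℝ), Integrable φ ρ :=
    fun ρ _ φ => φ.integrable ρ
  have hbdd : ∀ u, BddBelow (S u) := fun u => by
    refine ⟨-‖u‖, ?_⟩
    rintro r ⟨φ, ψ, l, hl, hle, rfl⟩
    have := base (φ + BoundedContinuousFunction.const X ‖u‖) ψ l hl (fun x y => by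
      have := (neg_le_abs _).trans (u.norm_coe_le_norm (x, y))
      have := hle x y
      simp only [BoundedContinuousFunction.coe_add, Pi.add_apply,
        BoundedContinuousFunction.const_apply]
      linarith)
    simp only [BoundedContinuousFunction.coe_add, Pi.add_apply,
        BoundedContinuousFunction.const_apply] at this
    rw [integral_add (hInt _ _) (integrable_const _)] at this
    simp only [integral_const, probReal_univ, one_smul] at this
    linarith
  have hsmul : ∀ c : ℝ, 0 < c → ∀ u, sInf (S (c • u)) ≤ c * sInf (S u) := by
    intro c hc u
    rw [← div_le_iff₀' hc]
    refine le_csInf (hne u) ?_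
    rintro r ⟨φ, ψ, l, hl, hle, rfl⟩
    rw [div_le_iff₀' hc]
    refine csInf_le (hbdd _) ⟨c • φ, c • ψ, c * l, by positivity, fun x y => ?_, ?_⟩
    · simp only [BoundedContinuousFunction.coe_smul, smul_eq_mul]
      nlinarith [mul_le_mul_of_nonneg_left (hle x y) hc.le]
    · simp only [BoundedContinuousFunction.coe_smul, smul_eq_mul, integral_const_mul]
      ring
  obtain ⟨Λ, -, hΛ⟩ := exists_extension_of_le_sublinear (⊥ : (X × X →ᵇ ℝ) →ₗ.[ℝ] ℝ)
    (fun u => sInf (S u))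
    (fun c hc u => le_antisymm (hsmul c hc u) (by
      have := hsmul c⁻¹ (inv_pos.2 hc) (c • u)
      rw [inv_smul_smul₀ hc.ne'] at this
      calc c * sInf (S u) ≤ c * (c⁻¹ * sInf (S (c • u))) := mul_le_mul_of_nonneg_left this hc.le
        _ = sInf (S (c • u)) := by field_simp))
    (fun u v => by
      rw [← sub_le_iff_le_add]
      refine le_csInf (hne u) ?_
      rintro r ⟨φ, ψ, l, hl, hle, rfl⟩
      rw [sub_le_comm]
      refine le_csInf (hne v) ?_
      rintro r ⟨φ', ψ', l', hl', hle', rfl⟩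
      rw [sub_le_iff_le_add]
      refine csInf_le (hbdd _) ⟨φ + φ', ψ + ψ', l + l', by positivity, fun x y => ?_, ?_⟩
      · simp only [BoundedContinuousFunction.coe_add, Pi.add_apply]
        linarith [hle x y, hle' x y]
      · simp only [BoundedContinuousFunction.coe_add, Pi.add_apply]
        rw [integral_add (hInt _ _) (hInt _ _), integral_add (hInt _ _) (hInt _ _)]
        ring)
    (fun u => by
      have h0 : (u : X × X →ᵇ ℝ) = 0 := (Submodule.mem_bot ℝ).1 u.2
      have hu0 : u = 0 := Subtype.ext h0
      rw [hu0, LinearPMap.map_zero]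
      refine le_csInf (hne _) ?_
      rintro r ⟨φ, ψ, l, hl, hle, rfl⟩
      exact base φ ψ l hl (by simpa using hle))
  exact ⟨Λ, fun u φ ψ l hl hle => (hΛ u).trans (csInf_le (hbdd u) ⟨φ, ψ, l, hl, hle, rfl⟩)⟩

/-- The nontrivial half of Kantorovich duality, on a proper metric space. -/
lemma exists_coupling_of_dual_bound [ProperSpace X] [SecondCountableTopology X]
    (ν μ : Measure X) [IsProbabilityMeasure ν] [IsProbabilityMeasure μ]
    (h : X → X → ℝ) (h_cont : Continuous fun z : X × X => h z.1 z.2)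
    (h_nonneg : ∀ x y, 0 ≤ h x y) (H : ℝ)
    (hdual : ∀ φ ψ : X →ᵇ ℝ, (∀ x y, φ x - ψ y ≤ h x y) → ∫ x, φ x ∂ν - ∫ x, ψ x ∂μ ≤ H) :
    ∃ π : Measure (X × X), π.map Prod.fst = ν ∧ π.map Prod.snd = μ ∧
      ∫⁻ z, ENNReal.ofReal (h z.1 z.2) ∂π ≤ ENNReal.ofReal H := by
  obtain ⟨Λ, hΛ⟩ := exists_coupling_functional ν μ h h_nonneg H hdual
  have : Nonempty X := nonempty_of_isProbabilityMeasure ν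
  let a : X := Classical.arbitrary X
  let tens : (X →ᵇ ℝ) → (X →ᵇ ℝ) → (X × X →ᵇ ℝ) := fun φ ψ =>
    φ.compContinuous ⟨Prod.fst, continuous_fst⟩ + ψ.compContinuous ⟨Prod.snd, continuous_snd⟩
  have htens : ∀ φ ψ x y, tens φ ψ (x, y) = φ x + ψ y := fun φ ψ x y => rfl
  have hpos : ∀ u : X × X →ᵇ ℝ, (∀ y, 0 ≤ u y) → 0 ≤ Λ u := fun u hu => by
    have := hΛ (-u) 0 0 0 le_rfl (fun x y => by simpa using hu (x, y))
    simpa using this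
  have hmarg : ∀ φ ψ, Λ (tens φ ψ) = ∫ x, φ x ∂ν + ∫ x, ψ x ∂μ := fun φ ψ => by
    refine le_antisymm ?_ ?_
    · simpa using hΛ (tens φ ψ) φ ψ 0 le_rfl (fun x y => by simp [htens])
    · have := hΛ (-tens φ ψ) (-φ) (-ψ) 0 le_rfl (fun x y => by simp [htens])
      simp only [map_neg, BoundedContinuousFunction.coe_neg, Pi.neg_apply, integral_neg] at this
      linarith
  have hmono : ∀ u v : X × X →ᵇ ℝ, (∀ y, u y ≤ v y) → Λ u ≤ Λ v := fun u v huv => by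
    have := hpos (v - u) (fun y => by simpa using huv y)
    rw [map_sub] at this
    linarith
  let χ : ℕ → C_c(X × X, ℝ) := fun n =>
    ⟨⟨fun z => ballCutoff a n z.1 * ballCutoff a n z.2, by fun_prop⟩, by
      refine HasCompactSupport.of_support_subset_isCompact
        ((ballCutoff a n).hasCompactSupport.isCompact.prod
          (ballCutoff a n).hasCompactSupport.isCompact) ?_
      intro z hz
      have hz' : ballCutoff a n z.1 * ballCutoff a n z.2 ≠ 0 := hz
      exact ⟨subset_tsupport _ (left_ne_zero_of_mul hz'),
        subset_tsupport _ (right_ne_zero_of_mul hz')⟩⟩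
  have h0 : ∀ n y, 0 ≤ χ n y := fun n y =>
    mul_nonneg (ballCutoff_nonneg _ _ _) (ballCutoff_nonneg _ _ _)
  have h1 : ∀ n y, χ n y ≤ 1 := fun n y =>
    mul_le_one₀ (ballCutoff_le_one _ _ _) (ballCutoff_nonneg _ _ _) (ballCutoff_le_one _ _ _)
  have hone : Λ 1 = 1 := by
    have := hmarg 1 0
    have e : tens 1 0 = 1 := by ext z; simp [tens]
    rw [e] at this
    simpa using this
  obtain ⟨π, hπ, hrep⟩ := exists_finiteMeasure_of_tight_functional Λ hpos χ h0 h1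
    (fun z => by
      rw [← mul_one (1 : ℝ)]
      exact (tendsto_ballCutoff a z.1).mul (tendsto_ballCutoff a z.2)) (by
      let B : ℕ → (X →ᵇ ℝ) := fun n => (ballCutoff a n).toBoundedContinuousFunction
      have low : ∀ n, (∫ x, ballCutoff a n x ∂ν) + (∫ x, ballCutoff a n x ∂μ) - 1
          ≤ Λ (χ n).toBoundedContinuousFunction := fun n => by
        have e : (∫ x, ballCutoff a n x ∂ν) + (∫ x, ballCutoff a n x ∂μ) - 1
            = Λ (tens (B n) (B n) - 1) := by
          rw [map_sub, hmarg, hone]; rfl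
        rw [e]
        refine hmono _ _ fun z => ?_
        change ballCutoff a n z.1 + ballCutoff a n z.2 - 1
          ≤ ballCutoff a n z.1 * ballCutoff a n z.2
        nlinarith [ballCutoff_le_one a n z.1, ballCutoff_le_one a n z.2]
      refine tendsto_of_tendsto_of_tendsto_of_le_of_le ?_ tendsto_const_nhds low
        (fun n => hmono _ _ fun z => h1 n z)
      rw [hone]
      have := ((tendsto_integral_ballCutoff ν a).add (tendsto_integral_ballCutoff μ a)).sub_const 1
      simpa using this)
  refine ⟨π, ?_, ?_, ?_⟩
  · refine ext_of_forall_integral_eq_of_IsFiniteMeasure fun φ => ?_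
    rw [integral_map (by fun_prop) φ.continuous.aestronglyMeasurable]
    have := (hrep (tens φ 0)).trans (hmarg φ 0)
    simpa [tens] using this
  · refine ext_of_forall_integral_eq_of_IsFiniteMeasure fun φ => ?_
    rw [integral_map (by fun_prop) φ.continuous.aestronglyMeasurable]
    have := (hrep (tens 0 φ)).trans (hmarg 0 φ)
    simpa [tens] using this
  · let hn : ℕ → (X × X →ᵇ ℝ) := fun n =>
      BoundedContinuousFunction.ofNormedAddCommGroup (fun z => min (h z.1 z.2) n)
        (h_cont.min continuous_const) n (fun z => by
          rw [Real.norm_eq_abs, abs_of_nonneg (le_min (h_nonneg _ _) n.cast_nonneg)]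
          exact min_le_right _ _)
    have hle : ∀ n, ∫⁻ z, ENNReal.ofReal (hn n z) ∂π ≤ ENNReal.ofReal H := fun n => by
      rw [← ofReal_integral_eq_lintegral_ofReal ((hn n).integrable π)
        (ae_of_all _ fun z => le_min (h_nonneg _ _) n.cast_nonneg), hrep]
      refine ENNReal.ofReal_le_ofReal ?_
      have := hΛ (hn n) 0 0 1 zero_le_one (fun x y => by
        simp [hn])
      simpa using this
    have hF := lintegral_liminf_le (μ := π) (u := atTop) (f := fun n z => ENNReal.ofReal (hn n z))
      (fun n => (hn n).continuous.measurable.ennreal_ofReal)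
    have heq : ∀ z, liminf (fun n => ENNReal.ofReal (hn n z)) atTop
        = ENNReal.ofReal (h z.1 z.2) := fun z => by
      refine Tendsto.liminf_eq (tendsto_const_nhds.congr' ?_)
      filter_upwards [eventually_ge_atTop ⌈h z.1 z.2⌉₊] with n hnn
      exact congrArg _ (min_eq_left (Nat.ceil_le.1 hnn)).symm
    simp only [heq] at hF
    exact hF.trans (liminf_le_of_frequently_le' (Frequently.of_forall hle))

end Kantorovich

section Young

variable {α : ℝ → ℝ}

namespace IsYoung

lemma continuous (hα : IsYoung α) : Continuous α := by
  rw [← continuousOn_univ]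
  exact hα.convex.continuousOn isOpen_univ

lemma pos (hα : IsYoung α) {x : ℝ} (hx : 0 < x) : 0 < α x := by
  simpa [hα.zero] using hα.mono self_mem_Ici hx.le hx

lemma hasDerivWithinAt_rightD (hα : IsYoung α) (x : ℝ) :
    HasDerivWithinAt α (rightD α x) (Ioi x) x :=
  hα.convex.hasDerivWithinAt_rightDeriv_of_mem_interior (by simp)

lemma tangent_le (hα : IsYoung α) (u x : ℝ) : α u + rightD α u * (x - u) ≤ α x := by
  rcases lt_trichotomy u x with h | h | h
  · have := hα.convex.rightDeriv_le_slope_of_mem_interior (x := u) (y := x) (by simp) (mem_univ _) h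
    rw [slope_def_field, le_div_iff₀ (by linarith)] at this
    unfold rightD
    linarith
  · simp [h]
  · have h1 := hα.convex.slope_le_leftDeriv_of_mem_interior (x := x) (y := u) (mem_univ _) (by simp) h
    have h2 := hα.convex.leftDeriv_le_rightDeriv_of_mem_interior (x := u) (by simp)
    have h3 := h1.trans h2
    rw [slope_def_field, div_le_iff₀ (by linarith)] at h3
    unfold rightD
    linarith

lemma rightD_pos (hα : IsYoung α) {u : ℝ} (hu : 0 < u) : 0 < rightD α u := by
  have h1 := hα.tangent_le u 0
  have h2 := hα.pos hu
  rw [hα.zero] at h1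
  by_contra hcon
  nlinarith

end IsYoung

lemma legendre_le_of_abs_le (hα : IsYoung α) {y z : ℝ} (h : |y| ≤ z) :
    legendre α y ≤ legendre α z := by
  refine iSup_le fun x => le_iSup_of_le |x| (ENNReal.ofReal_le_ofReal ?_)
  have e : α |x| = α x := by
    rcases abs_choice x with h | h <;> rw [h]
    exact hα.even x
  have : x * y ≤ |x| * z := by
    calc x * y ≤ |x * y| := le_abs_self _
      _ = |x| * |y| := abs_mul _ _
      _ ≤ |x| * z := mul_le_mul_of_nonneg_left h (abs_nonneg _)
  linarith

lemma legendre_zero (hα : IsYoung α) : legendre α 0 = 0 := by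
  refine le_antisymm (iSup_le fun x => ?_) zero_le
  rw [ENNReal.ofReal_of_nonpos]
  simpa using hα.nonneg x

lemma legendre_pos (hα : IsYoung α) {y : ℝ} (hy : 0 < y) : 0 < legendre α y := by
  have h := hα.hasDerivWithinAt_rightD 0
  rw [hα.rightD_zero, hasDerivWithinAt_iff_tendsto_slope' (by simp)] at h
  obtain ⟨x, hx, hx0⟩ := ((h.eventually (gt_mem_nhds hy)).and self_mem_nhdsWithin).exists
  have hx0' : 0 < x := hx0
  rw [slope_def_field, hα.zero, sub_zero, sub_zero, div_lt_iff₀ hx0'] at hx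
  refine lt_of_lt_of_le (ENNReal.ofReal_pos.2 ?_)
    (le_iSup (fun x => ENNReal.ofReal (x * y - α x)) x)
  linarith

lemma legendre_mul_le (hα : IsYoung α) {s : ℝ} (hs : 0 ≤ s) (hs1 : s ≤ 1) (y : ℝ) :
    legendre α (s * y) ≤ ENNReal.ofReal s * legendre α y := by
  refine iSup_le fun x => le_trans ?_ (mul_le_mul_right (le_iSup _ x) _)
  rw [← ENNReal.ofReal_mul hs]
  refine ENNReal.ofReal_le_ofReal ?_
  nlinarith [hα.nonneg x]

lemma legendre_mul_le_of_deltaTwo {K : ℝ} (hK : 0 < K) (hΔ : ∀ x, α (2 * x) ≤ K * α x) (y : ℝ) :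
    legendre α (2 / K * y) ≤ ENNReal.ofReal (1 / K) * legendre α y := by
  refine iSup_le fun x => le_trans ?_ (mul_le_mul_right (le_iSup _ (2 * x)) _)
  rw [← ENNReal.ofReal_mul (by positivity)]
  refine ENNReal.ofReal_le_ofReal ?_
  have := mul_le_mul_of_nonneg_left (hΔ x) (one_div_pos.2 hK).le
  have e : 1 / K * (K * α x) = α x := by field_simp
  rw [e] at this
  have e2 : x * (2 / K * y) = 1 / K * (2 * x * y) := by ring
  rw [e2, mul_sub]
  linarith

lemma xiAlpha_mul_le {s c : ℝ} (hs : 0 < s)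
    (h : ∀ y, legendre α (s * y) ≤ ENNReal.ofReal c * legendre α y) (t : ℝ) :
    xiAlpha α (s * t) ≤ ENNReal.ofReal (c / s) * xiAlpha α t := by
  refine iSup_le fun u => le_trans ?_ (mul_le_mul_right (le_iSup _ u) _)
  have hs' : ENNReal.ofReal s ≠ 0 := by simpa using hs
  rw [mul_assoc s, mul_assoc s, ENNReal.ofReal_mul hs.le, ENNReal.ofReal_div_of_pos hs]
  calc legendre α (s * (t * rightD α u)) / (ENNReal.ofReal s * ENNReal.ofReal (t * α u))
      ≤ ENNReal.ofReal c * legendre α (t * rightD α u)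
        / (ENNReal.ofReal s * ENNReal.ofReal (t * α u)) := ENNReal.div_le_div_right (h _) _
    _ = _ := by
      simp only [div_eq_mul_inv]
      rw [ENNReal.mul_inv (Or.inl hs') (Or.inl ENNReal.ofReal_ne_top)]
      ring

lemma xiAlpha_mono (hα : IsYoung α) {s t : ℝ} (hs : 0 < s) (hst : s ≤ t) :
    xiAlpha α s ≤ xiAlpha α t := by
  have ht : 0 < t := hs.trans_le hst
  have hr : 0 < s / t := by positivity
  have h := xiAlpha_mul_le hr
    (legendre_mul_le hα hr.le ((div_le_one ht).2 hst)) t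
  rw [div_mul_cancel₀ _ ht.ne', div_self hr.ne'] at h
  simpa using h

lemma xiAlpha_one_lt_top (hα : IsYoung α) (hΔ : DeltaTwo α) : xiAlpha α 1 < ⊤ := by
  obtain ⟨K, hK, hΔ⟩ := hΔ
  refine lt_of_le_of_lt (iSup_le fun u => ?_) (ENNReal.ofReal_lt_top (r := K))
  obtain ⟨u, hu⟩ := u
  simp only [one_mul]
  refine ENNReal.div_le_of_le_mul ?_
  rw [← ENNReal.ofReal_mul hK.le]
  refine iSup_le fun x => ENNReal.ofReal_le_ofReal ?_
  have h1 := hα.tangent_le u x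
  have h2 := hα.tangent_le u (2 * u)
  have h3 := hΔ u
  have h4 := hα.pos hu
  nlinarith

lemma xiAlpha_pos (hα : IsYoung α) {t : ℝ} (ht : 0 < t) : 0 < xiAlpha α t := by
  refine lt_of_lt_of_le ?_ (le_iSup _ (⟨1, one_pos⟩ : {u : ℝ // 0 < u}))
  exact ENNReal.div_pos (legendre_pos hα (mul_pos ht (hα.rightD_pos one_pos))).ne'
    ENNReal.ofReal_ne_top

/-- Under the `Δ₂`-condition, `ξ_α` grows at least like a power. -/
lemma exists_xiAlpha_le_rpow (hα : IsYoung α) (hΔ : DeltaTwo α) :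
    ∃ δ : ℝ, 0 < δ ∧ ∀ x y : ℝ, 0 < x → x ≤ y →
      xiAlpha α x ≤ ENNReal.ofReal (2 * (x / y) ^ δ) * xiAlpha α y := by
  obtain ⟨K₀, hK₀, hΔ₀⟩ := hΔ
  set K := max K₀ 3 with hKdef
  have hK3 : 3 ≤ K := le_max_right _ _
  have hΔ : ∀ x, α (2 * x) ≤ K * α x := fun x =>
    (hΔ₀ x).trans (mul_le_mul_of_nonneg_right (le_max_left _ _) (hα.nonneg x))
  have hK : 0 < K := by linarith
  have hκ : 0 < 2 / K := by positivity
  have half : ∀ t, xiAlpha α (2 / K * t) ≤ ENNReal.ofReal (1 / 2) * xiAlpha α t := fun t => by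
    have := xiAlpha_mul_le hκ (legendre_mul_le_of_deltaTwo hK hΔ) t
    have e : 1 / K / (2 / K) = 1 / 2 := by field_simp
    rwa [e] at this
  have iter : ∀ (n : ℕ) t, xiAlpha α ((2 / K) ^ n * t)
      ≤ ENNReal.ofReal ((1 / 2) ^ n) * xiAlpha α t := by
    intro n t
    induction n with
    | zero => simp
    | succ n ih =>
      rw [pow_succ', mul_assoc, pow_succ', ENNReal.ofReal_mul (by norm_num), mul_assoc]
      exact (half _).trans (mul_le_mul_right ih _)
  set ℓ := Real.log (K / 2) with hℓ
  have hℓ0 : 0 < ℓ := Real.log_pos (by linarith)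
  have hκℓ : 2 / K = Real.exp (-ℓ) := by
    rw [hℓ, Real.exp_neg, Real.exp_log (by positivity), inv_div]
  refine ⟨Real.log 2 / ℓ, by positivity, fun x y hx hxy => ?_⟩
  have hy : 0 < y := hx.trans_le hxy
  set z := Real.log (y / x) / ℓ with hz
  have hz0 : 0 ≤ z := div_nonneg (Real.log_nonneg ((one_le_div hx).2 hxy)) hℓ0.le
  have hxz : x / y = Real.exp (-(z * ℓ)) := by
    rw [hz, div_mul_cancel₀ _ hℓ0.ne', Real.exp_neg, Real.exp_log (by positivity), inv_div]
  set n := ⌊z⌋₊ with hn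
  have hn1 : (n : ℝ) ≤ z := Nat.floor_le hz0
  have hn2 : z < n + 1 := Nat.lt_floor_add_one z
  have hxn : x ≤ (2 / K) ^ n * y := by
    rw [← div_le_iff₀ hy, hxz, hκℓ, ← Real.exp_nat_mul]
    refine Real.exp_le_exp.2 ?_
    nlinarith
  refine (xiAlpha_mono hα hx hxn).trans ((iter n y).trans (mul_le_mul_left ?_ _))
  refine ENNReal.ofReal_le_ofReal ?_
  have e1 : (x / y) ^ (Real.log 2 / ℓ) = Real.exp (-(z * Real.log 2)) := by
    rw [hxz, ← Real.exp_mul]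
    congr 1
    field_simp
  have e2 : ((1 : ℝ) / 2) ^ n = Real.exp (-(n * Real.log 2)) := by
    rw [Real.exp_neg, Real.exp_nat_mul, Real.exp_log two_pos, one_div, inv_pow]
  have e3 : (2 : ℝ) = Real.exp (Real.log 2) := (Real.exp_log two_pos).symm
  rw [e1, e2]
  nth_rewrite 2 [e3]
  rw [← Real.exp_add]
  refine Real.exp_le_exp.2 ?_
  nlinarith [Real.log_pos (one_lt_two (α := ℝ))]

end Young

section Rate

lemma sum_mul_log_le_integral {e : ℝ → ℝ} {t : ℝ} (ht : 0 < t) (he : MonotoneOn e (Ioc 0 t))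
    (he0 : ∀ u, 0 ≤ e u)
    (hInt : IntervalIntegrable (fun u => e u / u) volume 0 t) {x : ℝ} (hx : 0 < x) (N : ℕ) :
    (∑ i ∈ Finset.range N, e (t * Real.exp (-x) ^ (i + 1))) * x
      ≤ ∫ u in (0 : ℝ)..t, e u / u := by
  set r := Real.exp (-x) with hr
  have hr0 : 0 < r := Real.exp_pos _
  have hr1 : r ≤ 1 := Real.exp_le_one_iff.2 (by linarith)
  have hpow : ∀ i : ℕ, t * r ^ i ≤ t := fun i =>
    mul_le_of_le_one_right ht.le (pow_le_one₀ hr0.le hr1)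
  have hsub : ∀ a b, 0 ≤ a → a ≤ b → b ≤ t →
      IntervalIntegrable (fun u => e u / u) volume a b := fun a b ha hab hb =>
    hInt.mono_set (by
      rw [uIcc_of_le hab, uIcc_of_le ht.le]
      exact Icc_subset_Icc ha hb)
  have key : ∀ N : ℕ, (∑ i ∈ Finset.range N, e (t * r ^ (i + 1))) * x
      ≤ ∫ u in (t * r ^ N)..t, e u / u := by
    intro N
    induction N with
    | zero => simp
    | succ N ih =>
      have h0 : 0 < t * r ^ (N + 1) := by positivity
      have hle : t * r ^ (N + 1) ≤ t * r ^ N :=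
        mul_le_mul_of_nonneg_left (pow_le_pow_of_le_one hr0.le hr1 N.le_succ) ht.le
      rw [Finset.sum_range_succ, add_mul, ← intervalIntegral.integral_add_adjacent_intervals
        (hsub _ _ h0.le hle (hpow N)) (hsub _ _ (by positivity) (hpow N) le_rfl), add_comm]
      refine add_le_add ?_ ih
      have hlog : x = Real.log (t * r ^ N / (t * r ^ (N + 1))) := by
        have : t * r ^ N / (t * r ^ (N + 1)) = Real.exp x := by
          rw [pow_succ, hr, Real.exp_neg]; field_simp
        rw [this, Real.log_exp]
      have hii : IntervalIntegrable (fun u : ℝ => e (t * r ^ (N + 1)) * u⁻¹) volume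
          (t * r ^ (N + 1)) (t * r ^ N) := by
        refine ContinuousOn.intervalIntegrable ?_
        rw [uIcc_of_le hle]
        exact continuousOn_const.mul (continuousOn_inv₀.mono fun u hu => (h0.trans_le hu.1).ne')
      calc e (t * r ^ (N + 1)) * x
          = ∫ u in (t * r ^ (N + 1))..(t * r ^ N), e (t * r ^ (N + 1)) * u⁻¹ := by
            rw [intervalIntegral.integral_const_mul,
              integral_inv_of_pos h0 (by positivity), ← hlog]
        _ ≤ _ := by
          refine intervalIntegral.integral_mono_on hle hii (hsub _ _ h0.le hle (hpow N)) ?_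
          intro u hu
          have hu0 : 0 < u := h0.trans_le hu.1
          rw [div_eq_mul_inv]
          exact mul_le_mul_of_nonneg_right
            (he ⟨h0, hpow _⟩ ⟨hu0, hu.2.trans (hpow N)⟩ hu.1) (inv_nonneg.2 hu0.le)
  refine (key N).trans ?_
  rw [← intervalIntegral.integral_add_adjacent_intervals
        (hsub 0 (t * r ^ N) le_rfl (by positivity) (hpow N))
        (hsub (t * r ^ N) t (by positivity) (hpow N) le_rfl)]
  have : 0 ≤ ∫ u in (0 : ℝ)..(t * r ^ N), e u / u :=
    intervalIntegral.integral_nonneg (by positivity) fun u hu => div_nonneg (he0 u) hu.1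
  linarith

/-- A geometric grid on which the discrete product approximates the integral factor from below. -/
lemma exists_ratio_prod_lower_bound {e : ℝ → ℝ} {t c : ℝ} (ht : 0 < t)
    (he : MonotoneOn e (Ioc 0 t)) (he0 : ∀ u, 0 ≤ e u) (he1 : ∀ u, e u ≤ 1)
    (hInt : IntervalIntegrable (fun u => e u / u) volume 0 t)
    (hc : c < t * Real.exp (-∫ u in (0 : ℝ)..t, e u / u)) :
    ∃ r : ℝ, 0 < r ∧ r < 1 ∧
      ∀ N : ℕ, c ≤ t * ∏ i ∈ Finset.range N, (1 + (1 / r - 1) * e (t * r ^ i))⁻¹ := by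
  set I := ∫ u in (0 : ℝ)..t, e u / u with hI
  have hlim : Tendsto (fun x : ℝ => t * Real.exp (-((Real.exp x - 1) + (Real.exp x - 1) / x * I)))
      (𝓝[>] 0) (𝓝 (t * Real.exp (-(0 + 1 * I)))) := by
    have h1 : Tendsto (fun x : ℝ => Real.exp x - 1) (𝓝[>] 0) (𝓝 0) := by
      have : Tendsto (fun x : ℝ => Real.exp x - 1) (𝓝 0) (𝓝 (Real.exp 0 - 1)) :=
        (Real.continuous_exp.sub continuous_const).tendsto 0
      rw [Real.exp_zero, sub_self] at this
      exact this.mono_left nhdsWithin_le_nhds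
    have h2 : Tendsto (fun x : ℝ => (Real.exp x - 1) / x) (𝓝[>] 0) (𝓝 1) := by
      have := (Real.hasDerivAt_exp 0).hasDerivWithinAt (s := Ioi 0)
      rw [hasDerivWithinAt_iff_tendsto_slope' (by simp), Real.exp_zero] at this
      refine this.congr fun x => ?_
      rw [slope_def_field, Real.exp_zero, sub_zero]
    exact ((Real.continuous_exp.tendsto _).comp (h1.add (h2.mul_const I)).neg).const_mul t
  rw [zero_add, one_mul] at hlim
  obtain ⟨x, hxc, hx0⟩ := ((hlim.eventually (lt_mem_nhds hc)).and self_mem_nhdsWithin).exists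
  have hx : 0 < x := hx0
  refine ⟨Real.exp (-x), Real.exp_pos _, by rw [← Real.exp_zero]; exact Real.exp_lt_exp.2 (by linarith), fun N => ?_⟩
  refine hxc.le.trans (mul_le_mul_of_nonneg_left ?_ ht.le)
  have hinv : 1 / Real.exp (-x) = Real.exp x := by rw [Real.exp_neg, one_div, inv_inv]
  rw [hinv]
  set r := Real.exp (-x) with hr
  have hex : 0 < Real.exp x - 1 := by linarith [Real.add_one_lt_exp hx.ne']
  have hsum : ∑ i ∈ Finset.range N, e (t * r ^ i) ≤ 1 + I / x := by
    cases N with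
    | zero =>
      have := sum_mul_log_le_integral ht he he0 hInt hx 0
      rw [Finset.range_zero, Finset.sum_empty, zero_mul] at this
      simp only [Finset.range_zero, Finset.sum_empty]
      have : 0 ≤ I / x := div_nonneg this hx.le
      linarith
    | succ N =>
      rw [Finset.sum_range_succ']
      have := sum_mul_log_le_integral ht he he0 hInt hx N
      have h2 := (le_div_iff₀ hx).2 this
      linarith [he1 (t * r ^ 0)]
  calc Real.exp (-((Real.exp x - 1) + (Real.exp x - 1) / x * I))
      = Real.exp (-((Real.exp x - 1) * (1 + I / x))) := by congr 1; ring
    _ ≤ Real.exp (-((Real.exp x - 1) * ∑ i ∈ Finset.range N, e (t * r ^ i))) :=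
        Real.exp_le_exp.2 (neg_le_neg (mul_le_mul_of_nonneg_left hsum hex.le))
    _ = ∏ i ∈ Finset.range N, Real.exp (-((Real.exp x - 1) * e (t * r ^ i))) := by
        rw [← Real.exp_sum, Finset.mul_sum, Finset.sum_neg_distrib]
    _ ≤ _ := by
        refine Finset.prod_le_prod (fun i _ => (Real.exp_pos _).le) fun i _ => ?_
        rw [Real.exp_neg]
        have h3 : 0 ≤ (Real.exp x - 1) * e (t * r ^ i) := mul_nonneg hex.le (he0 _)
        refine inv_anti₀ (by linarith) ?_
        linarith [Real.add_one_le_exp ((Real.exp x - 1) * e (t * r ^ i))]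

variable {α : ℝ → ℝ}

/-- The weight `A ξ_α / (1 + A ξ_α)`. -/
noncomputable def xiWeight (α : ℝ → ℝ) (A u : ℝ) : ℝ :=
  A * (xiAlpha α u).toReal / (1 + A * (xiAlpha α u).toReal)

lemma integrand_eq_xiWeight_div (α : ℝ → ℝ) (A : ℝ) :
    (fun u => A * (xiAlpha α u).toReal / (u * (1 + A * (xiAlpha α u).toReal)))
      = fun u => xiWeight α A u / u := by
  funext u
  rw [xiWeight, div_div, mul_comm u]

lemma xiWeight_nonneg {A : ℝ} (hA : 0 < A) (u : ℝ) : 0 ≤ xiWeight α A u := by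
  unfold xiWeight; positivity

lemma xiWeight_le_one {A : ℝ} (hA : 0 < A) (u : ℝ) : xiWeight α A u ≤ 1 := by
  unfold xiWeight
  have : 0 ≤ A * (xiAlpha α u).toReal := by positivity
  rw [div_le_one (by linarith)]
  linarith

lemma xiWeight_le {A : ℝ} (hA : 0 < A) (u : ℝ) : xiWeight α A u ≤ A * (xiAlpha α u).toReal := by
  unfold xiWeight
  have : 0 ≤ A * (xiAlpha α u).toReal := by positivity
  exact div_le_self this (by linarith)

lemma monotoneOn_xiWeight (hα : IsYoung α) {A t : ℝ} (hA : 0 < A) (hξ : xiAlpha α t < ⊤) :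
    MonotoneOn (xiWeight α A) (Ioc 0 t) := by
  intro u hu v hv huv
  have hvt : xiAlpha α v ≠ ⊤ := ((xiAlpha_mono hα hv.1 hv.2).trans_lt hξ).ne
  have h1 : (xiAlpha α u).toReal ≤ (xiAlpha α v).toReal :=
    ENNReal.toReal_mono hvt (xiAlpha_mono hα hu.1 huv)
  have h2 : A * (xiAlpha α u).toReal ≤ A * (xiAlpha α v).toReal :=
    mul_le_mul_of_nonneg_left h1 hA.le
  have h0 : 0 ≤ A * (xiAlpha α u).toReal := by positivity
  unfold xiWeight
  rw [div_le_div_iff₀ (by linarith) (by linarith)]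
  nlinarith

lemma intervalIntegrable_xiWeight_div (hα : IsYoung α) (hΔ : DeltaTwo α) {A t : ℝ} (hA : 0 < A)
    (ht : 0 < t) (hξ : xiAlpha α t < ⊤) :
    IntervalIntegrable (fun u => xiWeight α A u / u) volume 0 t := by
  obtain ⟨δ, hδ, hpow⟩ := exists_xiAlpha_le_rpow hα hΔ
  have hdom : IntervalIntegrable (fun u : ℝ =>
      (A * 2 * (xiAlpha α t).toReal * (t ^ δ)⁻¹) * u ^ (δ - 1)) volume 0 t :=
    (intervalIntegral.intervalIntegrable_rpow' (by linarith)).const_mul _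
  refine hdom.mono_fun ?_ ?_
  · rw [uIoc_of_le ht.le]
    exact ((aemeasurable_restrict_of_monotoneOn measurableSet_Ioc
      (monotoneOn_xiWeight hα hA hξ)).div aemeasurable_id).aestronglyMeasurable
  · rw [uIoc_of_le ht.le]
    refine (ae_restrict_iff' measurableSet_Ioc).2 (ae_of_all _ fun u hu => ?_)
    have hu0 : 0 < u := hu.1
    have h1 : (xiAlpha α u).toReal ≤ 2 * (u / t) ^ δ * (xiAlpha α t).toReal := by
      have := ENNReal.toReal_mono (ENNReal.mul_ne_top ENNReal.ofReal_ne_top hξ.ne)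
        (hpow u t hu0 hu.2)
      rwa [ENNReal.toReal_mul, ENNReal.toReal_ofReal (by positivity)] at this
    beta_reduce
    rw [Real.norm_eq_abs, Real.norm_eq_abs, abs_of_nonneg (div_nonneg (xiWeight_nonneg hA u) hu0.le),
      abs_of_nonneg (by positivity), div_le_iff₀ hu0]
    calc xiWeight α A u ≤ A * (xiAlpha α u).toReal := xiWeight_le hA u
      _ ≤ A * (2 * (u / t) ^ δ * (xiAlpha α t).toReal) := mul_le_mul_of_nonneg_left h1 hA.le
      _ = _ := by
        rw [Real.div_rpow hu0.le ht.le, Real.rpow_sub_one hu0.ne']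
        field_simp

/-- The constants `(1/t) exp (∫₀ᵗ …)` are bounded below by a positive number. -/
lemma exists_pos_le_rate (hα : IsYoung α) (hΔ : DeltaTwo α) {A : ℝ} (hA : 0 < A) :
    ∃ b₀ : ℝ, 0 < b₀ ∧ ∀ t, 0 < t → xiAlpha α t < ⊤ →
      b₀ ≤ (1 / t) * Real.exp (∫ u in (0 : ℝ)..t, xiWeight α A u / u) := by
  obtain ⟨δ, hδ, hpow⟩ := exists_xiAlpha_le_rpow hα hΔ
  set x₁ := (xiAlpha α 1).toReal with hx₁
  have hx₁0 : 0 < x₁ :=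
    ENNReal.toReal_pos (xiAlpha_pos hα one_pos).ne' (xiAlpha_one_lt_top hα hΔ).ne
  set D := 2 / (A * x₁) with hD
  have hD0 : 0 < D := by positivity
  refine ⟨Real.exp (-(D / δ)), Real.exp_pos _, fun t ht hξ => ?_⟩
  have hInt := intervalIntegrable_xiWeight_div hα hΔ hA ht hξ
  have hsub : ∀ a b, 0 ≤ a → a ≤ b → b ≤ t →
      IntervalIntegrable (fun u => xiWeight α A u / u) volume a b := fun a b ha hab hb =>
    hInt.mono_set (by
      rw [uIcc_of_le hab, uIcc_of_le ht.le]
      exact Icc_subset_Icc ha hb)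
  have hnn : ∀ b, 0 ≤ b → 0 ≤ ∫ u in (0 : ℝ)..b, xiWeight α A u / u := fun b hb =>
    intervalIntegral.integral_nonneg hb fun u hu => div_nonneg (xiWeight_nonneg hA u) hu.1
  suffices h : Real.log t - D / δ ≤ ∫ u in (0 : ℝ)..t, xiWeight α A u / u by
    calc Real.exp (-(D / δ)) = (1 / t) * Real.exp (Real.log t - D / δ) := by
          rw [sub_eq_add_neg, Real.exp_add, Real.exp_log ht]; field_simp
      _ ≤ _ := mul_le_mul_of_nonneg_left (Real.exp_le_exp.2 h) (by positivity)
  rcases le_total t 1 with h1 | h1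
  · have := Real.log_nonpos ht.le h1
    have h2 := hnn t ht.le
    have : 0 ≤ D / δ := by positivity
    linarith
  · rw [← intervalIntegral.integral_add_adjacent_intervals (hsub 0 1 le_rfl zero_le_one h1)
      (hsub 1 t zero_le_one h1 le_rfl)]
    have hcont : ∀ p : ℝ, IntervalIntegrable (fun u : ℝ => u ^ p) volume 1 t := fun p => by
      refine ContinuousOn.intervalIntegrable fun u hu => ?_
      rw [uIcc_of_le h1] at hu
      exact (Real.continuousAt_rpow_const _ _ (Or.inl (by linarith [hu.1]))).continuousWithinAt
    have hpt : ∀ u ∈ Icc 1 t, u ^ (-1 : ℝ) - D * u ^ (-δ - 1) ≤ xiWeight α A u / u := by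
      intro u hu
      have hu0 : 0 < u := by linarith [hu.1]
      have hut : xiAlpha α u ≠ ⊤ := ((xiAlpha_mono hα hu0 hu.2).trans_lt hξ).ne
      have h2 : x₁ ≤ 2 * u ^ (-δ) * (xiAlpha α u).toReal := by
        have := ENNReal.toReal_mono (ENNReal.mul_ne_top ENNReal.ofReal_ne_top hut)
          (hpow 1 u one_pos hu.1)
        rw [ENNReal.toReal_mul, ENNReal.toReal_ofReal (by positivity), one_div,
          Real.inv_rpow hu0.le, ← Real.rpow_neg hu0.le] at this
        exact this
      set y := (xiAlpha α u).toReal with hy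
      have hy0 : 0 ≤ y := ENNReal.toReal_nonneg
      have h3 : 1 - D * u ^ (-δ) ≤ xiWeight α A u := by
        unfold xiWeight
        rw [← hy, le_div_iff₀ (by positivity)]
        have h4 : D * u ^ (-δ) * (A * y) = 2 * u ^ (-δ) * y / x₁ := by
          rw [hD]; field_simp
        have h5 : 1 ≤ 2 * u ^ (-δ) * y / x₁ := (one_le_div hx₁0).2 h2
        have h6 : 0 ≤ D * u ^ (-δ) := by positivity
        nlinarith
      rw [Real.rpow_neg_one, Real.rpow_sub_one hu0.ne', le_div_iff₀ hu0]
      calc (u⁻¹ - D * (u ^ (-δ) / u)) * u = 1 - D * u ^ (-δ) := by field_simp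
        _ ≤ _ := h3
    have hmono := intervalIntegral.integral_mono_on h1
      ((hcont (-1)).sub ((hcont (-δ - 1)).const_mul D)) (hsub 1 t zero_le_one h1 le_rfl) hpt
    have hne : (0 : ℝ) ∉ uIcc 1 t := by
      rw [uIcc_of_le h1]; intro h; linarith [h.1]
    rw [intervalIntegral.integral_sub (hcont _) ((hcont _).const_mul D),
      intervalIntegral.integral_const_mul, integral_rpow (r := -δ - 1) (Or.inr ⟨by linarith, hne⟩)] at hmono
    simp only [Real.rpow_neg_one, sub_add_cancel, Real.one_rpow] at hmono
    rw [integral_inv hne, div_one] at hmono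
    have h7 : D * ((t ^ (-δ) - 1) / -δ) ≤ D / δ := by
      have : 0 ≤ t ^ (-δ) := by positivity
      rw [div_neg, ← neg_div, neg_sub, mul_div_assoc']
      refine div_le_div_of_nonneg_right ?_ hδ.le
      nlinarith
    have := hnn 1 zero_le_one
    linarith

end Rate

section SupConvolution

variable {X : Type*} [MetricSpace X] {α : ℝ → ℝ} {f : X → ℝ} {M : ℝ}

/-- The sup-convolution `P^c f(x) = sup_y {f(y) - c α(d(x,y))}`. -/
noncomputable def supConv (α : ℝ → ℝ) (c : ℝ) (f : X → ℝ) (x : X) : ℝ :=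
  ⨆ y : X, (f y - c * α (dist x y))

lemma IsYoung.increment_le_increment (hα : IsYoung α) {a b δ : ℝ} (hab : a ≤ b) (hδ : 0 ≤ δ) :
    α (a + δ) - α a ≤ α (b + δ) - α b := by
  rcases hδ.eq_or_lt with rfl | hδ
  · simp
  rcases hab.eq_or_lt with rfl | hab
  · rfl
  have hw : 0 < b + δ - a := by linarith
  have hp : 0 ≤ (b - a) / (b + δ - a) := div_nonneg (by linarith) hw.le
  have hq : 0 ≤ δ / (b + δ - a) := by positivity
  have hpq : (b - a) / (b + δ - a) + δ / (b + δ - a) = 1 := by field_simp; ring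
  have h1 := hα.convex.2 (mem_univ a) (mem_univ (b + δ)) hp hq hpq
  have h2 := hα.convex.2 (mem_univ a) (mem_univ (b + δ)) hq hp (by rw [add_comm, hpq])
  simp only [smul_eq_mul] at h1 h2
  have e1 : (b - a) / (b + δ - a) * a + δ / (b + δ - a) * (b + δ) = a + δ := by
    field_simp; ring
  have e2 : δ / (b + δ - a) * a + (b - a) / (b + δ - a) * (b + δ) = b := by
    field_simp; ring
  rw [e1] at h1
  rw [e2] at h2
  have e3 : (b - a) / (b + δ - a) * α a + δ / (b + δ - a) * α (b + δ)
      + (δ / (b + δ - a) * α a + (b - a) / (b + δ - a) * α (b + δ)) = α a + α (b + δ) := by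
    field_simp; ring
  linarith

lemma IsYoung.le_of_le (hα : IsYoung α) {a b : ℝ} (ha : 0 ≤ a) (hab : a ≤ b) : α a ≤ α b :=
  hα.mono.monotoneOn ha (ha.trans hab) hab

lemma IsYoung.exists_radius (hα : IsYoung α) {c : ℝ} (hc : 0 < c) (M : ℝ) :
    ∃ R, 0 ≤ R ∧ ∀ d, 0 ≤ d → c * α d ≤ 2 * M → d ≤ R := by
  have h1 := hα.rightD_pos one_pos
  refine ⟨max 0 (1 + 2 * M / c / rightD α 1), le_max_left _ _, fun d hd h => ?_⟩
  refine le_trans ?_ (le_max_right _ _)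
  have h2 := hα.tangent_le 1 d
  have h3 := hα.nonneg 1
  have h4 : α d ≤ 2 * M / c := by rw [le_div_iff₀ hc]; linarith
  have h5 : d - 1 ≤ 2 * M / c / rightD α 1 := by rw [le_div_iff₀ h1]; nlinarith
  linarith

lemma bddAbove_supConv (hα : IsYoung α) {c : ℝ} (hc : 0 ≤ c) (hM : ∀ x, |f x| ≤ M) (x : X) :
    BddAbove (range fun y : X => f y - c * α (dist x y)) := by
  refine ⟨M, ?_⟩
  rintro _ ⟨y, rfl⟩
  have := mul_nonneg hc (hα.nonneg (dist x y))
  have := (abs_le.1 (hM y)).2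
  simp only
  linarith

lemma le_supConv (hα : IsYoung α) {c : ℝ} (hc : 0 ≤ c) (hM : ∀ x, |f x| ≤ M) (x y : X) :
    f y - c * α (dist x y) ≤ supConv α c f x :=
  le_ciSup (bddAbove_supConv hα hc hM x) y

lemma self_le_supConv (hα : IsYoung α) {c : ℝ} (hc : 0 ≤ c) (hM : ∀ x, |f x| ≤ M) (x : X) :
    f x ≤ supConv α c f x := by
  simpa [hα.zero] using le_supConv hα hc hM x x

lemma abs_supConv_le (hα : IsYoung α) {c : ℝ} (hc : 0 ≤ c) (hM : ∀ x, |f x| ≤ M) (x : X) :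
    |supConv α c f x| ≤ M := by
  have : Nonempty X := ⟨x⟩
  refine abs_le.2 ⟨(abs_le.1 (hM x)).1.trans (self_le_supConv hα hc hM x), ciSup_le fun y => ?_⟩
  have := mul_nonneg hc (hα.nonneg (dist x y))
  have := (abs_le.1 (hM y)).2
  linarith

lemma supConv_anti (hα : IsYoung α) {c c' : ℝ} (hc : 0 ≤ c) (hcc : c ≤ c')
    (hM : ∀ x, |f x| ≤ M) (x : X) : supConv α c' f x ≤ supConv α c f x := by
  have : Nonempty X := ⟨x⟩
  refine ciSup_le fun y => le_trans ?_ (le_supConv hα hc hM x y)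
  have := mul_le_mul_of_nonneg_right hcc (hα.nonneg (dist x y))
  linarith

lemma exists_eq_supConv [ProperSpace X] (hα : IsYoung α) {c : ℝ} (hc : 0 < c)
    (hf : Continuous f) (hM : ∀ x, |f x| ≤ M) (x : X) :
    ∃ y, supConv α c f x = f y - c * α (dist x y) := by
  have : Nonempty X := ⟨x⟩
  obtain ⟨R, hR, hRad⟩ := hα.exists_radius hc M
  have hcont : Continuous fun y => f y - c * α (dist x y) :=
    hf.sub (continuous_const.mul (hα.continuous.comp (continuous_const.dist continuous_id)))
  obtain ⟨y, hy, hmax⟩ := (isCompact_closedBall x R).exists_isMaxOn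
    ⟨x, Metric.mem_closedBall_self hR⟩ hcont.continuousOn
  refine ⟨y, le_antisymm (ciSup_le fun z => ?_) (le_supConv hα hc.le hM x y)⟩
  by_cases hz : c * α (dist x z) ≤ 2 * M
  · exact hmax (by rw [Metric.mem_closedBall, dist_comm]; exact hRad _ dist_nonneg hz)
  · have h1 : f x - c * α (dist x x) ≤ f y - c * α (dist x y) :=
      hmax (Metric.mem_closedBall_self hR)
    rw [dist_self, hα.zero, mul_zero, sub_zero] at h1
    have := abs_le.1 (hM x)
    have := abs_le.1 (hM z)
    push Not at hz
    linarith

lemma dist_le_of_eq_supConv (hα : IsYoung α) {c : ℝ} (hc : 0 < c) (hM : ∀ x, |f x| ≤ M)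
    {R : ℝ} (hR : ∀ d, 0 ≤ d → c * α d ≤ 2 * M → d ≤ R) {x y : X}
    (hy : supConv α c f x = f y - c * α (dist x y)) : dist x y ≤ R := by
  refine hR _ dist_nonneg ?_
  have := self_le_supConv hα hc.le hM x
  have := abs_le.1 (hM x)
  have := abs_le.1 (hM y)
  linarith

lemma supConv_sub_le (hα : IsYoung α) {c : ℝ} (hc : 0 < c) (hM : ∀ x, |f x| ≤ M) {x y : X}
    (hy : supConv α c f x = f y - c * α (dist x y)) (z : X) :
    supConv α c f x - supConv α c f z ≤ c * (α (dist x y + dist z x) - α (dist x y)) := by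
  have h1 := le_supConv hα hc.le hM z y
  have h2 : α (dist z y) ≤ α (dist x y + dist z x) :=
    hα.le_of_le dist_nonneg (by linarith [dist_triangle z x y])
  have := mul_le_mul_of_nonneg_left h2 hc.le
  linarith

lemma locallyLipschitz_supConv [ProperSpace X] (hα : IsYoung α) {c : ℝ} (hc : 0 < c)
    (hf : Continuous f) (hM : ∀ x, |f x| ≤ M) : LocallyLipschitz (supConv α c f) := by
  obtain ⟨R, hR, hRad⟩ := hα.exists_radius hc M
  have hL : 0 ≤ c * (α (R + 1) - α R) :=
    mul_nonneg hc.le (sub_nonneg.2 (hα.le_of_le hR (by linarith)))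
  have key : ∀ x z : X, dist z x ≤ 1 →
      supConv α c f x - supConv α c f z ≤ c * (α (R + 1) - α R) * dist z x := by
    intro x z hzx
    obtain ⟨y, hy⟩ := exists_eq_supConv hα hc hf hM x
    refine (supConv_sub_le hα hc hM hy z).trans ?_
    have h1 := hα.increment_le_increment (dist_le_of_eq_supConv hα hc hM hRad hy)
      (dist_nonneg (x := z) (y := x))
    have h2 := hα.convex.2 (mem_univ R) (mem_univ (R + 1)) (sub_nonneg.2 hzx)
      (dist_nonneg (x := z) (y := x)) (by ring)
    simp only [smul_eq_mul] at h2
    have e : (1 - dist z x) * R + dist z x * (R + 1) = R + dist z x := by ring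
    rw [e] at h2
    have h3 : α (dist x y + dist z x) - α (dist x y) ≤ (α (R + 1) - α R) * dist z x := by
      linarith
    rw [mul_assoc]
    exact mul_le_mul_of_nonneg_left h3 hc.le
  intro x
  refine ⟨(c * (α (R + 1) - α R)).toNNReal, Metric.ball x (1 / 2),
    Metric.ball_mem_nhds _ (by norm_num), LipschitzOnWith.of_dist_le_mul fun p hp q hq => ?_⟩
  have hpq : dist p q ≤ 1 := by
    have := dist_triangle_right p q x
    rw [Metric.mem_ball] at hp hq
    linarith
  rw [Real.coe_toNNReal _ hL, Real.dist_eq, abs_le]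
  have h1 := key p q (by rwa [dist_comm])
  have h2 := key q p hpq
  rw [dist_comm q p] at h1
  constructor <;> linarith

lemma abs_gradMinus_le_of_tendsto {g : X → ℝ} {x : X} {k L : ℝ} (φ : ℝ → ℝ)
    (hφ : Tendsto φ (𝓝[>] 0) (𝓝 L)) (hL : 0 ≤ L) (hk : 0 ≤ k)
    (hg : ∀ y, y ≠ x → max (-(g y - g x)) 0 / dist y x ≤ k * φ (dist y x)) :
    |gradMinus g x| ≤ k * L := by
  unfold gradMinus
  rcases (𝓝[≠] x).eq_or_neBot with hbot | hne
  · rw [hbot]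
    have : limsup (fun y => max (-(g y - g x)) 0 / dist y x) (⊥ : Filter X) = 0 := by
      simp [limsup, limsSup]
    rw [this, abs_zero]
    positivity
  · have hdist : Tendsto (fun y => dist y x) (𝓝[≠] x) (𝓝[>] 0) := by
      refine tendsto_nhdsWithin_iff.2 ⟨?_, ?_⟩
      · have : Tendsto (fun y => dist y x) (𝓝 x) (𝓝 (dist x x)) :=
          (continuous_id.dist continuous_const).tendsto x
        rw [dist_self] at this
        exact this.mono_left nhdsWithin_le_nhds
      · filter_upwards [self_mem_nhdsWithin] with y hy
        exact dist_pos.2 hy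
    have ht : Tendsto (fun y => k * φ (dist y x)) (𝓝[≠] x) (𝓝 (k * L)) :=
      (hφ.comp hdist).const_mul k
    have hle : (fun y => max (-(g y - g x)) 0 / dist y x) ≤ᶠ[𝓝[≠] x] fun y => k * φ (dist y x) := by
      filter_upwards [self_mem_nhdsWithin] with y hy
      exact hg y hy
    have h0 : ∀ y, 0 ≤ max (-(g y - g x)) 0 / dist y x := fun y =>
      div_nonneg (le_max_right _ _) dist_nonneg
    have hbdd : IsBoundedUnder (· ≤ ·) (𝓝[≠] x) fun y => max (-(g y - g x)) 0 / dist y x :=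
      ht.isBoundedUnder_le.mono_le hle
    rw [abs_of_nonneg]
    · rw [← ht.limsup_eq]
      exact limsup_le_limsup hle (isBoundedUnder_of ⟨0, h0⟩).isCoboundedUnder_le
        ht.isBoundedUnder_le
    · exact le_limsup_of_frequently_le (Frequently.of_forall h0) hbdd

/-- The descending slope of `P^c f / m` at `x` is controlled by the distance to a maximiser. -/
lemma abs_gradMinus_supConv_le (hα : IsYoung α) {c m : ℝ} (hc : 0 < c) (hm : 0 < m)
    (hM : ∀ x, |f x| ≤ M) {x y : X} (hy : supConv α c f x = f y - c * α (dist x y)) :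
    |gradMinus (fun z => supConv α c f z / m) x| ≤ c / m * rightD α (dist x y) := by
  have hD : 0 ≤ rightD α (dist x y) := by
    rcases (dist_nonneg (x := x) (y := y)).eq_or_lt with h | h
    · rw [← h, hα.rightD_zero]
    · exact (hα.rightD_pos h).le
  refine abs_gradMinus_le_of_tendsto (fun ε => (α (dist x y + ε) - α (dist x y)) / ε) ?_ hD
    (by positivity) fun z hz => ?_
  · have h := hα.hasDerivWithinAt_rightD (dist x y)
    rw [hasDerivWithinAt_iff_tendsto_slope' (by simp)] at h
    have ht : Tendsto (fun ε : ℝ => dist x y + ε) (𝓝[>] 0) (𝓝[>] (dist x y)) := by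
      refine tendsto_nhdsWithin_iff.2 ⟨?_, ?_⟩
      · have : Tendsto (fun ε : ℝ => dist x y + ε) (𝓝 0) (𝓝 (dist x y + 0)) :=
          (continuous_const.add continuous_id).tendsto 0
        rw [add_zero] at this
        exact this.mono_left nhdsWithin_le_nhds
      · filter_upwards [self_mem_nhdsWithin] with ε hε
        have : (0 : ℝ) < ε := hε
        simpa using this
    refine (h.comp ht).congr fun ε => ?_
    simp [slope_def_field]
  · have hzx : 0 < dist z x := dist_pos.2 hz
    rw [mul_div_assoc']
    refine div_le_div_of_nonneg_right (max_le ?_ ?_) hzx.le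
    · have := supConv_sub_le hα hc hM hy z
      rw [div_mul_eq_mul_div, neg_sub, ← sub_div]
      exact div_le_div_of_nonneg_right this hm.le
    · exact mul_nonneg (by positivity) (sub_nonneg.2 (hα.le_of_le dist_nonneg (by linarith)))

end SupConvolution

section Entropy

/-- Bounded continuous real functions, as a predicate. -/
def IsContBdd {X : Type*} [TopologicalSpace X] (g : X → ℝ) : Prop :=
  Continuous g ∧ IsBoundedFun g

namespace IsContBdd

section Algebra

variable {X : Type*} [TopologicalSpace X] {g h : X → ℝ}

lemma const (a : ℝ) : IsContBdd fun _ : X => a := ⟨continuous_const, |a|, fun _ => le_rfl⟩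

lemma sub (hg : IsContBdd g) (hh : IsContBdd h) : IsContBdd fun x => g x - h x := by
  obtain ⟨hg, M, hM⟩ := hg
  obtain ⟨hh, N, hN⟩ := hh
  exact ⟨hg.sub hh, M + N, fun x => (abs_sub _ _).trans (add_le_add (hM x) (hN x))⟩

lemma mul (hg : IsContBdd g) (hh : IsContBdd h) : IsContBdd fun x => g x * h x := by
  obtain ⟨hg, M, hM⟩ := hg
  obtain ⟨hh, N, hN⟩ := hh
  refine ⟨hg.mul hh, M * N, fun x => ?_⟩
  rw [abs_mul]
  exact mul_le_mul (hM x) (hN x) (abs_nonneg _) ((abs_nonneg _).trans (hM x))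

lemma div_const (hg : IsContBdd g) (a : ℝ) : IsContBdd fun x => g x / a := by
  simpa only [div_eq_mul_inv] using hg.mul (const a⁻¹)

lemma exp (hg : IsContBdd g) : IsContBdd fun x => Real.exp (g x) := by
  obtain ⟨hg, M, hM⟩ := hg
  refine ⟨Real.continuous_exp.comp hg, Real.exp M, fun x => ?_⟩
  rw [abs_of_pos (Real.exp_pos _)]
  exact Real.exp_le_exp.2 ((le_abs_self _).trans (hM x))

end Algebra

variable {X : Type*} [TopologicalSpace X] [MeasurableSpace X] [BorelSpace X] {g h : X → ℝ}

lemma integrable (hg : IsContBdd g) (μ : Measure X) [IsFiniteMeasure μ] :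
    Integrable g μ := by
  obtain ⟨hg, M, hM⟩ := hg
  exact Integrable.of_bound hg.measurable.aestronglyMeasurable M (ae_of_all _ hM)

lemma integral_exp_pos (hg : IsContBdd g) (μ : Measure X) [IsProbabilityMeasure μ] :
    0 < ∫ x, Real.exp (g x) ∂μ :=
  MeasureTheory.integral_exp_pos (hg.exp.integrable μ)

/-- Jensen's inequality for the Gibbs measure of `h`. -/
lemma log_integral_exp_add_le (hg : IsContBdd g) (hh : IsContBdd h) (μ : Measure X)
    [IsProbabilityMeasure μ] :
    Real.log (∫ x, Real.exp (h x) ∂μ)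
        + (∫ x, (g x - h x) * Real.exp (h x) ∂μ) / ∫ x, Real.exp (h x) ∂μ
      ≤ Real.log (∫ x, Real.exp (g x) ∂μ) := by
  have hΦ := hh.integral_exp_pos μ
  set Φ := ∫ x, Real.exp (h x) ∂μ with hΦd
  set J := ∫ x, (g x - h x) * Real.exp (h x) ∂μ with hJ
  set a := J / Φ with ha
  have h1 : Real.exp a * Φ ≤ ∫ x, Real.exp (g x) ∂μ := by
    have hi1 := ((hg.sub hh).mul hh.exp).integrable μ
    have hi2 := hh.exp.integrable μ
    have e : Real.exp a * Φ = ∫ x, Real.exp a *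
        ((g x - h x) * Real.exp (h x) + (1 - a) * Real.exp (h x)) ∂μ := by
      rw [integral_const_mul, integral_add hi1 (hi2.const_mul _), integral_const_mul, ← hJ, ← hΦd]
      have : J = a * Φ := by rw [ha]; field_simp
      rw [this]; ring
    rw [e]
    refine integral_mono ((hi1.add (hi2.const_mul _)).const_mul _) (hg.exp.integrable μ) fun x => ?_
    have h2 := Real.add_one_le_exp (g x - h x - a)
    have h3 : Real.exp (g x) = Real.exp a * (Real.exp (h x) * Real.exp (g x - h x - a)) := by
      rw [← Real.exp_add, ← Real.exp_add]; congr 1; ring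
    beta_reduce
    rw [h3]
    refine mul_le_mul_of_nonneg_left ?_ (Real.exp_pos _).le
    have := mul_le_mul_of_nonneg_left h2 (Real.exp_pos (h x)).le
    linarith
  have h2 := Real.log_le_log (by positivity) h1
  rw [Real.log_mul (Real.exp_pos _).ne' hΦ.ne', Real.log_exp] at h2
  linarith

lemma mul_log_integral_exp_div_le (hg : Continuous g) {M m : ℝ} (hM : ∀ x, |g x| ≤ M)
    (hm : 0 < m) (hMm : M ≤ m) (μ : Measure X) [IsProbabilityMeasure μ] :
    m * Real.log (∫ x, Real.exp (g x / m) ∂μ) ≤ ∫ x, g x ∂μ + M ^ 2 / m := by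
  have hgb : IsContBdd g := ⟨hg, M, hM⟩
  have hpos := (hgb.div_const m).integral_exp_pos μ
  have h1 : ∫ x, Real.exp (g x / m) ∂μ ≤ ∫ x, (g x / m + (1 + M ^ 2 / m ^ 2)) ∂μ := by
    refine integral_mono ((hgb.div_const m).exp.integrable μ)
      (((hgb.div_const m).integrable μ).add (integrable_const _)) fun x => ?_
    have h2 : |g x / m| ≤ 1 := by
      rw [abs_div, abs_of_pos hm, div_le_one hm]
      exact (hM x).trans hMm
    have h3 := (abs_le.1 (Real.abs_exp_sub_one_sub_id_le h2)).2
    have h4 : (g x / m) ^ 2 ≤ M ^ 2 / m ^ 2 := by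
      rw [div_pow]
      exact div_le_div_of_nonneg_right (sq_le_sq' (abs_le.1 (hM x)).1 (abs_le.1 (hM x)).2)
        (by positivity)
    beta_reduce
    linarith
  rw [integral_add ((hgb.div_const m).integrable μ) (integrable_const _), integral_div,
    integral_const, probReal_univ, one_smul] at h1
  have h5 := Real.log_le_sub_one_of_pos hpos
  calc m * Real.log (∫ x, Real.exp (g x / m) ∂μ)
      ≤ m * ((∫ x, g x ∂μ) / m + M ^ 2 / m ^ 2) :=
        mul_le_mul_of_nonneg_left (by linarith) hm.le
    _ = _ := by field_simp

end IsContBdd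

lemma legendre_mul_rightD_le {α : ℝ → ℝ} (hα : IsYoung α) {s d : ℝ} (hs : 0 < s) (hd : 0 ≤ d)
    (hξ : xiAlpha α s < ⊤) :
    legendre α (s * rightD α d) ≤ ENNReal.ofReal (s * (xiAlpha α s).toReal * α d) := by
  rcases hd.eq_or_lt with rfl | hd
  · rw [hα.rightD_zero, mul_zero, legendre_zero hα]
    exact zero_le
  · have h1 : legendre α (s * rightD α d) / ENNReal.ofReal (s * α d) ≤ xiAlpha α s :=
      le_iSup (fun u : {u : ℝ // 0 < u} =>
        legendre α (s * rightD α u) / ENNReal.ofReal (s * α u)) ⟨d, hd⟩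
    have h2 : 0 < s * α d := mul_pos hs (hα.pos hd)
    rw [ENNReal.div_le_iff (by simpa using h2) ENNReal.ofReal_ne_top] at h1
    refine h1.trans (le_of_eq ?_)
    rw [← ENNReal.ofReal_toReal hξ.ne, ← ENNReal.ofReal_mul ENNReal.toReal_nonneg,
      ENNReal.toReal_ofReal ENNReal.toReal_nonneg]
    congr 1; ring

lemma isContBdd_supConv {X : Type*} [MetricSpace X] [ProperSpace X] {α : ℝ → ℝ} {f : X → ℝ}
    {M : ℝ} (hα : IsYoung α) {c : ℝ} (hc : 0 < c) (hf : Continuous f)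
    (hM : ∀ x, |f x| ≤ M) : IsContBdd (supConv α c f) :=
  ⟨(locallyLipschitz_supConv hα hc hf hM).continuous, M, abs_supConv_le hα hc.le hM⟩

variable {X : Type*} [MetricSpace X] [ProperSpace X] [MeasurableSpace X] [BorelSpace X]
  {α : ℝ → ℝ} {f : X → ℝ} {M A : ℝ} {μ : Measure X} [IsProbabilityMeasure μ]

lemma mul_entExp_supConv_le (hα : IsYoung α) (hA : 0 < A) (hLSI : LSIminus μ α A)
    (hf : Continuous f) (hM : ∀ x, |f x| ≤ M) {c c' m : ℝ} (hc : 0 < c) (hcc : c < c')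
    (hm : 0 < m) (hξ : xiAlpha α (c' / m) < ⊤) :
    (c' - c) * entExp μ (fun x => supConv α c' f x / m) ≤
      A * (c' / m * (xiAlpha α (c' / m)).toReal) *
        ∫ x, (supConv α c f x - supConv α c' f x) * Real.exp (supConv α c' f x / m) ∂μ := by
  have hc' : 0 < c' := hc.trans hcc
  have hcd : 0 < c' - c := sub_pos.2 hcc
  set x₀ := (xiAlpha α (c' / m)).toReal with hx₀
  have hx₀0 : 0 ≤ x₀ := ENNReal.toReal_nonneg
  have hb := isContBdd_supConv hα hc hf hM
  have hb' := isContBdd_supConv hα hc' hf hM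
  have hlip : LocallyLipschitz fun x => supConv α c' f x / m := by
    simp only [div_eq_mul_inv]
    have : LipschitzWith ‖m⁻¹‖₊ fun z : ℝ => z * m⁻¹ :=
      LipschitzWith.of_dist_le_mul fun y z => by
        rw [Real.dist_eq, ← sub_mul, abs_mul, mul_comm, Real.dist_eq, coe_nnnorm, Real.norm_eq_abs]
    exact this.locallyLipschitz.comp (locallyLipschitz_supConv hα hc' hf hM)
  have h1 := hLSI _ (hb'.div_const m).2 hlip
  have hle : ∀ x, 0 ≤ supConv α c f x - supConv α c' f x := fun x =>
    sub_nonneg.2 (supConv_anti hα hc.le hcc.le hM x)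
  have hInt := ((hb.sub hb').mul (hb'.div_const m).exp).integrable μ
  have h2 : ∫⁻ x, legendre α (gradMinus (fun x => supConv α c' f x / m) x)
        * ENNReal.ofReal (Real.exp (supConv α c' f x / m)) ∂μ
      ≤ ENNReal.ofReal (∫ x, c' / m * x₀ / (c' - c) *
          ((supConv α c f x - supConv α c' f x) * Real.exp (supConv α c' f x / m)) ∂μ) := by
    rw [ofReal_integral_eq_lintegral_ofReal (hInt.const_mul _) (ae_of_all _ fun x =>
      mul_nonneg (by positivity) (mul_nonneg (hle x) (Real.exp_pos _).le))]
    refine lintegral_mono fun x => ?_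
    obtain ⟨y, hy⟩ := exists_eq_supConv hα hc' hf hM x
    have h3 := (legendre_le_of_abs_le hα (abs_gradMinus_supConv_le hα hc' hm hM hy)).trans
      (legendre_mul_rightD_le hα (by positivity) dist_nonneg hξ)
    have h4 : α (dist x y) ≤ (supConv α c f x - supConv α c' f x) / (c' - c) := by
      rw [le_div_iff₀ hcd]
      have := le_supConv hα hc.le hM x y
      linarith
    refine (mul_le_mul_left h3 _).trans ?_
    rw [← ENNReal.ofReal_mul (mul_nonneg (by positivity) (hα.nonneg _))]
    refine ENNReal.ofReal_le_ofReal ?_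
    calc c' / m * x₀ * α (dist x y) * Real.exp (supConv α c' f x / m)
        ≤ c' / m * x₀ * ((supConv α c f x - supConv α c' f x) / (c' - c))
          * Real.exp (supConv α c' f x / m) := by
          gcongr
      _ = _ := by ring
  have h5 := h1.trans (mul_le_mul_right h2 _)
  have hI : 0 ≤ ∫ x, (supConv α c f x - supConv α c' f x)
      * Real.exp (supConv α c' f x / m) ∂μ :=
    integral_nonneg fun x => mul_nonneg (hle x) (Real.exp_pos _).le
  rw [integral_const_mul, ← ENNReal.ofReal_mul hA.le,
    ENNReal.ofReal_le_ofReal_iff (by positivity)] at h5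
  calc _ ≤ (c' - c) * _ := mul_le_mul_of_nonneg_left h5 hcd.le
    _ = _ := by field_simp

/-- One step of the discretised Hamilton-Jacobi semigroup argument. -/
lemma mul_log_integral_exp_supConv_le (hα : IsYoung α) (hA : 0 < A) (hLSI : LSIminus μ α A)
    (hf : Continuous f) (hM : ∀ x, |f x| ≤ M) {c c' m m' : ℝ} (hc : 0 < c) (hcc : c < c')
    (hm' : 0 < m') (hm : 0 < m) (hξ : xiAlpha α (c' / m') < ⊤)
    (hstep : c' - c = (m - m') * (A * (c' / m' * (xiAlpha α (c' / m')).toReal))) :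
    m' * Real.log (∫ x, Real.exp (supConv α c' f x / m') ∂μ)
      ≤ m * Real.log (∫ x, Real.exp (supConv α c f x / m) ∂μ) := by
  have hc' : 0 < c' := hc.trans hcc
  have hb := isContBdd_supConv hα hc hf hM
  have hb' := isContBdd_supConv hα hc' hf hM
  have hent := mul_entExp_supConv_le hα hA hLSI hf hM hc hcc hm' hξ
  have hcd : 0 < c' - c := sub_pos.2 hcc
  set K := A * (c' / m' * (xiAlpha α (c' / m')).toReal) with hK
  have hK0 : 0 ≤ K := by positivity
  have hKpos : 0 < K := by
    refine hK0.lt_of_ne fun h => ?_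
    rw [← h, mul_zero] at hstep
    exact hcd.ne' hstep
  have hJ := (hb.div_const m).log_integral_exp_add_le (hb'.div_const m') μ
  have hΦ := (hb'.div_const m').integral_exp_pos μ
  simp only [entExp, Real.log_exp] at hent
  set Φ := ∫ x, Real.exp (supConv α c' f x / m') ∂μ with hΦd
  set E := ∫ x, Real.exp (supConv α c' f x / m') * (supConv α c' f x / m') ∂μ with hE
  set W := ∫ x, (supConv α c f x - supConv α c' f x) * Real.exp (supConv α c' f x / m') ∂μ with hW
  have hent' : (m - m') * (E - Φ * Real.log Φ) ≤ W := by
    rw [hstep, mul_right_comm] at hent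
    rw [mul_comm K] at hent
    exact le_of_mul_le_mul_right hent hKpos
  have hsplit : m * ∫ x, (supConv α c f x / m - supConv α c' f x / m')
      * Real.exp (supConv α c' f x / m') ∂μ = W - (m - m') * E := by
    rw [hW, hE, ← integral_const_mul, ← integral_const_mul, ← integral_sub
      (((hb.sub hb').mul (hb'.div_const m').exp).integrable μ)
      ((((hb'.div_const m').exp.mul (hb'.div_const m')).integrable μ).const_mul _)]
    refine integral_congr_ae (ae_of_all _ fun x => ?_)
    field_simp
    ring
  refine le_trans ?_ (mul_le_mul_of_nonneg_left hJ hm.le)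
  rw [mul_add, mul_div_assoc', hsplit]
  have : -((m - m') * Real.log Φ) ≤ (W - (m - m') * E) / Φ := by
    rw [le_div_iff₀ hΦ]
    linarith
  linarith

/-- The dual form of the transport-entropy inequality. -/
lemma log_integral_exp_le_integral_supConv (hα : IsYoung α) (hΔ : DeltaTwo α) (hA : 0 < A)
    (hLSI : LSIminus μ α A) (hf : Continuous f) (hM : ∀ x, |f x| ≤ M) {t c : ℝ} (ht : 0 < t)
    (hξ : xiAlpha α t < ⊤) (hc : 0 < c)
    (hct : c < t * Real.exp (-∫ u in (0 : ℝ)..t, xiWeight α A u / u)) :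
    Real.log (∫ x, Real.exp (f x) ∂μ) ≤ ∫ x, supConv α c f x ∂μ := by
  obtain ⟨r, hr0, hr1, hr⟩ := exists_ratio_prod_lower_bound ht (monotoneOn_xiWeight hα hA hξ)
    (xiWeight_nonneg hA) (xiWeight_le_one hA) (intervalIntegrable_xiWeight_div hα hΔ hA ht hξ) hct
  set cc : ℕ → ℝ := fun N =>
    t * ∏ i ∈ Finset.range N, (1 + (1 / r - 1) * xiWeight α A (t * r ^ i))⁻¹ with hcc
  set mm : ℕ → ℝ := fun N => cc N / (t * r ^ N) with hmm
  have hs : ∀ N : ℕ, 0 < t * r ^ N := fun N => by positivity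
  have hcpos : ∀ N, 0 < cc N := fun N => hc.trans_le (hr N)
  have hmpos : ∀ N, 0 < mm N := fun N => div_pos (hcpos N) (hs N)
  have hcm : ∀ N, cc N / mm N = t * r ^ N := fun N => by
    have := (hcpos N).ne'
    have := (hs N).ne'
    rw [hmm]; field_simp
  have hq : 0 < 1 / r - 1 := sub_pos.2 ((one_lt_div hr0).2 hr1)
  have hstep : ∀ N, mm N * Real.log (∫ x, Real.exp (supConv α (cc N) f x / mm N) ∂μ)
      ≤ mm (N + 1) * Real.log (∫ x, Real.exp (supConv α (cc (N + 1)) f x / mm (N + 1)) ∂μ) := by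
    intro N
    have hξN : xiAlpha α (t * r ^ N) < ⊤ := (xiAlpha_mono hα (hs N)
      (mul_le_of_le_one_right ht.le (pow_le_one₀ hr0.le hr1.le))).trans_lt hξ
    have hx : 0 < (xiAlpha α (t * r ^ N)).toReal :=
      ENNReal.toReal_pos (xiAlpha_pos hα (hs N)).ne' hξN.ne
    have hsucc : cc (N + 1) = cc N * (1 + (1 / r - 1) * xiWeight α A (t * r ^ N))⁻¹ := by
      simp only [hcc]
      rw [Finset.prod_range_succ, mul_assoc]
    have he : 0 < xiWeight α A (t * r ^ N) := by unfold xiWeight; positivity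
    have hden : 1 < 1 + (1 / r - 1) * xiWeight α A (t * r ^ N) := by
      have := mul_pos hq he
      linarith
    refine mul_log_integral_exp_supConv_le hα hA hLSI hf hM (hcpos _) ?_ (hmpos _) (hmpos _)
      (by rwa [hcm]) ?_
    · rw [hsucc]
      exact mul_lt_of_lt_one_right (hcpos N) (inv_lt_one_of_one_lt₀ hden)
    · rw [hcm]
      have hmN : mm N = cc N / (t * r ^ N) := rfl
      have hmN1 : mm (N + 1) = cc (N + 1) / (t * r ^ N * r) := by
        simp only [hmm]; rw [pow_succ, mul_assoc]
      rw [hmN1, hmN, hsucc]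
      have hsN := (hs N).ne'
      have hden' := (one_pos.trans hden).ne'
      unfold xiWeight at hden' ⊢
      set y := (xiAlpha α (t * r ^ N)).toReal with hy
      set s := t * r ^ N with hs'
      have h1 : 1 + A * y ≠ 0 := by positivity
      have h2 : r + A * y ≠ 0 := by positivity
      have h3 : (1 + (1 / r - 1) * (A * y / (1 + A * y)))⁻¹
          = r * (1 + A * y) / (r + A * y) := by
        rw [inv_eq_iff_eq_inv, inv_div]
        field_simp
        ring
      rw [h3]
      field_simp
      ring
  have hmono : Monotone fun N =>
      mm N * Real.log (∫ x, Real.exp (supConv α (cc N) f x / mm N) ∂μ) :=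
    monotone_nat_of_le_succ hstep
  have hstart : Real.log (∫ x, Real.exp (f x) ∂μ)
      ≤ mm 0 * Real.log (∫ x, Real.exp (supConv α (cc 0) f x / mm 0) ∂μ) := by
    have hc0 : cc 0 = t := by simp [hcc]
    have hm0 : mm 0 = 1 := by simp [hmm, hc0, ht.ne']
    have hfb : IsContBdd f := ⟨hf, M, hM⟩
    simp only [hm0, hc0, one_mul, div_one]
    exact Real.log_le_log (hfb.integral_exp_pos μ) (integral_mono (hfb.exp.integrable μ)
      ((isContBdd_supConv hα ht hf hM).exp.integrable μ) fun x =>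
        Real.exp_le_exp.2 (self_le_supConv hα ht.le hM x))
  have hmlim : Tendsto mm atTop atTop := by
    have h1 : Tendsto (fun N : ℕ => c / t * r⁻¹ ^ N) atTop atTop :=
      (tendsto_pow_atTop_atTop_of_one_lt ((one_lt_inv₀ hr0).2 hr1)).const_mul_atTop (by positivity)
    refine tendsto_atTop_mono (fun N => ?_) h1
    calc c / t * r⁻¹ ^ N = c / (t * r ^ N) := by rw [inv_pow]; field_simp
      _ ≤ mm N := div_le_div_of_nonneg_right (hr N) (hs N).le
  have hbound : ∀ᶠ N in atTop, Real.log (∫ x, Real.exp (f x) ∂μ)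
      ≤ ∫ x, supConv α c f x ∂μ + M ^ 2 / mm N := by
    filter_upwards [hmlim.eventually_ge_atTop M] with N hN
    have h1 := IsContBdd.mul_log_integral_exp_div_le
      (isContBdd_supConv hα (hcpos N) hf hM).1 (abs_supConv_le hα (hcpos N).le hM)
      (hmpos N) hN μ
    have h2 : ∫ x, supConv α (cc N) f x ∂μ ≤ ∫ x, supConv α c f x ∂μ :=
      integral_mono ((isContBdd_supConv hα (hcpos N) hf hM).integrable μ)
        ((isContBdd_supConv hα hc hf hM).integrable μ) (supConv_anti hα hc.le (hr N) hM)
    have h3 := hmono (Nat.zero_le N)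
    simp only at h3
    linarith
  have hlim : Tendsto (fun N => ∫ x, supConv α c f x ∂μ + M ^ 2 / mm N) atTop
      (𝓝 (∫ x, supConv α c f x ∂μ + 0)) :=
    tendsto_const_nhds.add (tendsto_const_nhds.div_atTop hmlim)
  rw [add_zero] at hlim
  exact ge_of_tendsto hlim hbound

end Entropy

section Duality

lemma integral_le_integral_llr_add_log {X : Type*} [TopologicalSpace X] [MeasurableSpace X]
    [BorelSpace X] {ν μ : Measure X} [IsProbabilityMeasure ν] [IsProbabilityMeasure μ]
    {f : X → ℝ} (hf : IsContBdd f) (hac : ν ≪ μ) (hInt : Integrable (llr ν μ) ν) :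
    ∫ x, f x ∂ν ≤ ∫ x, llr ν μ x ∂ν + Real.log (∫ x, Real.exp (f x) ∂μ) := by
  have he := hf.exp.integrable μ
  have hfν := hf.integrable ν
  have : IsProbabilityMeasure (μ.tilted f) := isProbabilityMeasure_tilted he
  have h := InformationTheory.integral_llr_add_sub_measure_univ_nonneg
    (hac.trans (absolutelyContinuous_tilted he)) (integrable_llr_tilted_right hac hfν hInt he)
  rw [integral_llr_tilted_right hac hfν he hInt, probReal_univ, probReal_univ] at h
  linarith

variable {X : Type*} [MetricSpace X] [ProperSpace X] [MeasurableSpace X] [BorelSpace X]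
  [SecondCountableTopology X] {α : ℝ → ℝ} {A : ℝ} {μ ν : Measure X} [IsProbabilityMeasure μ]
  [IsProbabilityMeasure ν]

lemma transportCost_le_of_lt (hα : IsYoung α) (hΔ : DeltaTwo α) (hA : 0 < A)
    (hLSI : LSIminus μ α A) (hac : ν ≪ μ) (hInt : Integrable (llr ν μ) ν) {t c : ℝ} (ht : 0 < t)
    (hξ : xiAlpha α t < ⊤) (hc : 0 < c)
    (hct : c < t * Real.exp (-∫ u in (0 : ℝ)..t, xiWeight α A u / u)) :
    transportCost α ν μ ≤ ENNReal.ofReal c⁻¹ * ENNReal.ofReal (∫ x, llr ν μ x ∂ν) := by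
  have hdual : ∀ φ ψ : X →ᵇ ℝ, (∀ x y, φ x - ψ y ≤ c * α (dist x y)) →
      ∫ x, φ x ∂ν - ∫ x, ψ x ∂μ ≤ ∫ x, llr ν μ x ∂ν := by
    intro φ ψ hφψ
    have hφM : ∀ x, |φ x| ≤ ‖φ‖ := φ.norm_coe_le_norm
    have hφ : IsContBdd φ := ⟨φ.continuous, ‖φ‖, hφM⟩
    have hψ : IsContBdd ψ := ⟨ψ.continuous, ‖ψ‖, ψ.norm_coe_le_norm⟩
    have h1 := integral_le_integral_llr_add_log hφ hac hInt
    have h2 := log_integral_exp_le_integral_supConv hα hΔ hA hLSI φ.continuous hφM ht hξ hc hct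
    have h3 : ∫ x, supConv α c φ x ∂μ ≤ ∫ x, ψ x ∂μ := by
      refine integral_mono ((isContBdd_supConv hα hc φ.continuous hφM).integrable μ)
        (hψ.integrable μ) fun x => ?_
      have : Nonempty X := ⟨x⟩
      refine ciSup_le fun y => ?_
      have := hφψ y x
      rw [dist_comm x y]
      linarith
    linarith
  obtain ⟨π, h1, h2, hπ⟩ := exists_coupling_of_dual_bound ν μ (fun x y => c * α (dist x y))
    (continuous_const.mul (hα.continuous.comp continuous_dist))
    (fun x y => mul_nonneg hc.le (hα.nonneg _)) (∫ x, llr ν μ x ∂ν) hdual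
  have hle : transportCost α ν μ ≤ ∫⁻ z, ENNReal.ofReal (α (dist z.1 z.2)) ∂π :=
    sInf_le ⟨π, h1, h2, rfl⟩
  refine hle.trans ?_
  simp only [ENNReal.ofReal_mul hc.le] at hπ
  rw [lintegral_const_mul' _ _ ENNReal.ofReal_ne_top] at hπ
  rw [ENNReal.ofReal_inv_of_pos hc, ← ENNReal.div_eq_inv_mul,
    ENNReal.le_div_iff_mul_le (Or.inl (by simpa using hc)) (Or.inl ENNReal.ofReal_ne_top),
    mul_comm]
  exact hπ

lemma transportCost_le_rate (hα : IsYoung α) (hΔ : DeltaTwo α) (hA : 0 < A)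
    (hLSI : LSIminus μ α A) (hac : ν ≪ μ) (hInt : Integrable (llr ν μ) ν) {t : ℝ} (ht : 0 < t)
    (hξ : xiAlpha α t < ⊤) :
    transportCost α ν μ ≤ ENNReal.ofReal
      ((1 / t) * Real.exp (∫ u in (0 : ℝ)..t, xiWeight α A u / u))
        * ENNReal.ofReal (∫ x, llr ν μ x ∂ν) := by
  set c₀ := t * Real.exp (-∫ u in (0 : ℝ)..t, xiWeight α A u / u) with hc₀
  have hpos : 0 < c₀ := by positivity
  have e : (1 / t) * Real.exp (∫ u in (0 : ℝ)..t, xiWeight α A u / u) = c₀⁻¹ := by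
    rw [hc₀, Real.exp_neg, mul_inv, inv_inv, one_div]
  rw [e]
  have hlim : Tendsto (fun c : ℝ => ENNReal.ofReal c⁻¹ * ENNReal.ofReal (∫ x, llr ν μ x ∂ν))
      (𝓝[<] c₀) (𝓝 (ENNReal.ofReal c₀⁻¹ * ENNReal.ofReal (∫ x, llr ν μ x ∂ν))) := by
    refine ENNReal.Tendsto.mul_const ?_ (Or.inr ENNReal.ofReal_ne_top)
    exact ENNReal.tendsto_ofReal ((tendsto_inv₀ hpos.ne').mono_left nhdsWithin_le_nhds)
  refine ge_of_tendsto hlim ?_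
  filter_upwards [self_mem_nhdsWithin, nhdsWithin_le_nhds (lt_mem_nhds hpos)] with c hc hc0
  exact transportCost_le_of_lt hα hΔ hA hLSI hac hInt ht hξ hc0 hc

end Duality

theorem lsi_minus_implies_transport_entropy_Bminus
    {X : Type*} [MetricSpace X] [CompleteSpace X] [TopologicalSpace.SeparableSpace X]
    [ProperSpace X] [MeasurableSpace X] [BorelSpace X]
    (α : ℝ → ℝ) (hα : IsYoung α) (hΔ : DeltaTwo α)
    (μ : Measure X) [IsProbabilityMeasure μ] (A : ℝ) (hA : 0 < A)
    (hLSI : LSIminus μ α A) :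
    TransportEntropy μ α
      (sInf {b : ℝ | ∃ t : ℝ, 0 < t ∧ xiAlpha α t < ⊤ ∧
        b = (1 / t) * Real.exp (∫ u in (0:ℝ)..t,
          A * (xiAlpha α u).toReal / (u * (1 + A * (xiAlpha α u).toReal)))}) := by
  have hsc : SecondCountableTopology X := UniformSpace.secondCountable_of_separable X
  intro ν hν
  rw [integrand_eq_xiWeight_div α A]
  obtain ⟨b₀, hb₀, hrate⟩ := exists_pos_le_rate hα hΔ hA
  set S : Set ℝ := {b : ℝ | ∃ t : ℝ, 0 < t ∧ xiAlpha α t < ⊤ ∧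
    b = (1 / t) * Real.exp (∫ u in (0 : ℝ)..t, xiWeight α A u / u)} with hS
  have hne : S.Nonempty := ⟨_, 1, one_pos, xiAlpha_one_lt_top hα hΔ, rfl⟩
  have hlow : ∀ b ∈ S, b₀ ≤ b := by
    rintro _ ⟨t, ht, hξ, rfl⟩
    exact hrate t ht hξ
  have hpos : 0 < sInf S := hb₀.trans_le (le_csInf hne hlow)
  by_cases hfin : ν ≪ μ ∧ Integrable (fun x => Real.log (ν.rnDeriv μ x).toReal) ν
  · rw [relEnt, if_pos hfin]
    have hS' : ∀ b ∈ S, transportCost α ν μ ≤ ENNReal.ofReal b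
        * ENNReal.ofReal (∫ x, Real.log (ν.rnDeriv μ x).toReal ∂ν) := by
      rintro _ ⟨t, ht, hξ, rfl⟩
      exact transportCost_le_rate hα hΔ hA hLSI hfin.1 hfin.2 ht hξ
    obtain ⟨b, -, hb, hbS⟩ := exists_seq_tendsto_sInf hne ⟨b₀, hlow⟩
    exact ge_of_tendsto (ENNReal.Tendsto.mul_const (ENNReal.tendsto_ofReal hb)
      (Or.inr ENNReal.ofReal_ne_top)) (Eventually.of_forall fun n => hS' _ (hbS n))
  · rw [relEnt, if_neg hfin, ENNReal.mul_top (by simpa using hpos)]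
    exact le_top
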